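/- arXiv:2009.13881 — 2 statements merged into one kernel-verified Lean document; each statement's English description precedes it below -/
import Mathlib

section
/- Let K ⊆ ℝ^d be a bounded set, L > 0, and ‖·‖ a norm on ℝ^d. Fix the ReLU activation φ(x) = max{0, x}. For every ε > 0 and every function f : ℝ^d → ℝ that is L-Lipschitz on K, there exist m ∈ ℕ and a one-hidden-layer ReLU network f_m(x) = b + ∑_{i=1}^m aᵢ φ(∑_j w_{ij} x_j + cᵢ) such that f_m is L-Lipschitz on K (with respect to ‖·‖) and sup_{x ∈ K} |f(x) − f_m(x)| ≤ ε. -/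
open Finset

/-- `N` is a norm on `ℝ^d`. -/
def IsNorm {d : ℕ} (N : (Fin d → ℝ) → ℝ) : Prop :=
  (∀ x, N x = 0 ↔ x = 0) ∧ (∀ (c : ℝ) x, N (c • x) = |c| * N x) ∧
    (∀ x y, N (x + y) ≤ N x + N y)

/-- ReLU networks, as a submodule. -/
def Net (d : ℕ) : Submodule ℝ ((Fin d → ℝ) → ℝ) where
  carrier := {h | ∃ (m : ℕ) (b : ℝ) (a c : Fin m → ℝ) (w : Fin m → Fin d → ℝ),
    h = (fun x => b + ∑ i, a i * max 0 (∑ j, w i j * x j + c i))}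
  zero_mem' := ⟨0, 0, 0, 0, 0, by ext; simp⟩
  add_mem' := by
    rintro _ _ ⟨m, b, a, c, w, rfl⟩ ⟨m', b', a', c', w', rfl⟩
    refine ⟨m + m', b + b', Fin.append a a', Fin.append c c', Fin.append w w', ?_⟩
    ext x
    simp only [Pi.add_apply, Fin.sum_univ_add, Fin.append_left, Fin.append_right]
    ring
  smul_mem' := by
    rintro r _ ⟨m, b, a, c, w, rfl⟩
    refine ⟨m, r * b, fun i => r * a i, c, w, ?_⟩
    ext x
    simp only [Pi.smul_apply, smul_eq_mul, mul_add, Finset.mul_sum, mul_assoc]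

lemma Net.const_mem {d : ℕ} (b : ℝ) : (fun _ => b) ∈ Net d :=
  ⟨0, b, 0, 0, 0, by ext; simp⟩

lemma Net.relu_mem {d : ℕ} (w : Fin d → ℝ) (c : ℝ) :
    (fun x => max 0 (w ⬝ᵥ x + c)) ∈ Net d :=
  ⟨1, 0, fun _ => 1, fun _ => c, fun _ => w, by ext; simp [dotProduct]⟩

lemma exp_step {p q s t D : ℝ} (hs : p ≤ s) (ht : t ≤ q) (hst : s ≤ t)
    (hpq : Real.exp q - Real.exp p ≤ D) :
    |(Real.exp t - Real.exp p * t) - (Real.exp s - Real.exp p * s)| ≤ D * (t - s) := by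
  have h1 : Real.exp s * (t - s) ≤ Real.exp t - Real.exp s := by
    have := Real.add_one_le_exp (t - s)
    have h2 : Real.exp t = Real.exp s * Real.exp (t - s) := by rw [← Real.exp_add]; ring_nf
    nlinarith [Real.exp_pos s]
  have h2 : Real.exp t - Real.exp s ≤ Real.exp t * (t - s) := by
    have := Real.add_one_le_exp (s - t)
    have h2 : Real.exp s = Real.exp t * Real.exp (s - t) := by rw [← Real.exp_add]; ring_nf
    nlinarith [Real.exp_pos t]
  have h3 := Real.exp_le_exp.2 hs
  have h4 := Real.exp_le_exp.2 ht
  rw [abs_le]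
  constructor <;> nlinarith

lemma net_exp_aux {d : ℕ} (w : Fin d → ℝ) (S D : ℝ) (hD : 0 < D) (n : ℕ) :
    ∃ h : ℝ → ℝ, (fun x => h (w ⬝ᵥ x)) ∈ Net d ∧
      (∃ σ : ℝ, ∀ t, Real.log (Real.exp (-S) + n * D) ≤ t →
        h t = h (Real.log (Real.exp (-S) + n * D)) +
          σ * (t - Real.log (Real.exp (-S) + n * D))) ∧
      ∀ s t, -S ≤ s → s ≤ t → t ≤ Real.log (Real.exp (-S) + n * D) →
        |(Real.exp t - h t) - (Real.exp s - h s)| ≤ D * (t - s) := by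
  induction n with
  | zero =>
    refine ⟨fun _ => 0, Net.const_mem 0, ⟨0, by simp⟩, ?_⟩
    intro s t h1 h2 h3
    simp at h3
    have h4 : s = t := by linarith
    simp [h4]
  | succ n ih =>
    obtain ⟨h, hmem, ⟨σ, hσ⟩, hl⟩ := ih
    have hpos : 0 < Real.exp (-S) + n * D := by positivity
    have hpos' : 0 < Real.exp (-S) + (n + 1 : ℕ) * D := by positivity
    have hep := Real.exp_log hpos
    have heq := Real.exp_log hpos'
    have hpq : Real.log (Real.exp (-S) + n * D) ≤ Real.log (Real.exp (-S) + (n + 1 : ℕ) * D) := by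
      apply Real.log_le_log hpos
      push_cast; nlinarith
    set p := Real.log (Real.exp (-S) + n * D)
    set q := Real.log (Real.exp (-S) + (n + 1 : ℕ) * D)
    have hd : Real.exp q - Real.exp p ≤ D := by rw [hep, heq]; push_cast; linarith
    have hhi : ∀ t, p ≤ t → h t + (Real.exp p - σ) * max 0 (t + -p) = h p + Real.exp p * (t - p) := by
      intro t ht
      rw [max_eq_right (by linarith), hσ t ht]; ring
    have hlo : ∀ t, t ≤ p → h t + (Real.exp p - σ) * max 0 (t + -p) = h t := by
      intro t ht
      rw [max_eq_left (by linarith)]; ring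
    refine ⟨fun t => h t + (Real.exp p - σ) * max 0 (t + -p), ?_, ⟨Real.exp p, ?_⟩, ?_⟩
    · exact (Net d).add_mem hmem ((Net d).smul_mem _ (Net.relu_mem w (-p)))
    · intro t ht
      simp only
      rw [hhi t (hpq.trans ht), hhi q hpq]; ring
    · intro s t h1 h2 h3
      simp only
      rcases le_total t p with htp | htp
      · rw [hlo t htp, hlo s (h2.trans htp)]
        exact hl s t h1 h2 htp
      rcases le_total p s with hps | hps
      · rw [hhi t htp, hhi s hps]
        have := exp_step hps h3 h2 hd
        convert this using 2; ring
      · rw [hhi t htp, hlo s hps]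
        have a1 := exp_step le_rfl h3 htp hd
        have a2 := hl s p h1 hps le_rfl
        rw [abs_le] at *
        constructor <;> linarith [a1.1, a1.2, a2.1, a2.2]

lemma net_exp {d : ℕ} (w : Fin d → ℝ) (S D : ℝ) (hD : 0 < D) :
    ∃ h : ℝ → ℝ, (fun x => h (w ⬝ᵥ x)) ∈ Net d ∧
      ∀ s t, |s| ≤ S → |t| ≤ S →
        |(Real.exp t - h t) - (Real.exp s - h s)| ≤ D * |t - s| := by
  obtain ⟨n, hn⟩ := exists_nat_ge (Real.exp S / D)
  obtain ⟨h, hmem, -, hl⟩ := net_exp_aux w S D hD n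
  have hS : S ≤ Real.log (Real.exp (-S) + n * D) := by
    rw [Real.le_log_iff_exp_le (by positivity)]
    rw [div_le_iff₀ hD] at hn
    linarith [Real.exp_pos (-S)]
  refine ⟨h, hmem, ?_⟩
  intro s t hs ht
  rw [abs_le] at hs ht
  rcases le_total s t with hst | hst
  · rw [abs_of_nonneg (sub_nonneg.2 hst)]
    exact hl s t hs.1 hst (ht.2.trans hS)
  · rw [abs_sub_comm, abs_of_nonpos (sub_nonpos.2 hst), neg_sub]
    exact hl t s ht.1 hst (hs.2.trans hS)

/-- Span of ridge exponentials. -/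
def ExpSpan (d : ℕ) : Submodule ℝ ((Fin d → ℝ) → ℝ) :=
  Submodule.span ℝ (Set.range fun w : Fin d → ℝ => fun x => Real.exp (w ⬝ᵥ x))

lemma abs_dot_le {d : ℕ} (w x : Fin d → ℝ) : |w ⬝ᵥ x| ≤ (∑ j, |w j|) * ‖x‖ := by
  unfold dotProduct
  rw [Finset.sum_mul]
  refine (Finset.abs_sum_le_sum_abs _ _).trans (Finset.sum_le_sum fun j _ => ?_)
  rw [abs_mul]
  exact mul_le_mul_of_nonneg_left (norm_le_pi_norm x j) (abs_nonneg _)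

lemma ExpSpan.approx {d : ℕ} (R : ℝ) {g : (Fin d → ℝ) → ℝ} (hg : g ∈ ExpSpan d) :
    ∀ η > 0, ∃ h ∈ Net d, ∀ x y, ‖x‖ ≤ R → ‖y‖ ≤ R →
      |(g x - h x) - (g y - h y)| ≤ η * ‖x - y‖ := by
  induction hg using Submodule.span_induction with
  | mem g hg =>
    obtain ⟨w, rfl⟩ := hg
    intro η hη
    set W := ∑ j, |w j| with hW
    have hW0 : 0 ≤ W := Finset.sum_nonneg fun j _ => abs_nonneg _
    obtain ⟨h, hmem, hl⟩ := net_exp w (W * R) (η / (W + 1)) (by positivity)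
    refine ⟨_, hmem, ?_⟩
    intro x y hx hy
    have h1 := hl (w ⬝ᵥ y) (w ⬝ᵥ x) ((abs_dot_le w y).trans (by gcongr))
      ((abs_dot_le w x).trans (by gcongr))
    refine h1.trans ?_
    rw [← dotProduct_sub]
    calc η / (W + 1) * |w ⬝ᵥ (x - y)| ≤ η / (W + 1) * ((W + 1) * ‖x - y‖) := by
          gcongr
          refine (abs_dot_le w _).trans ?_
          gcongr
          linarith
      _ = _ := by field_simp
  | zero =>
    intro η hη
    refine ⟨0, (Net d).zero_mem, ?_⟩
    intro x y _ _
    simp; positivity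
  | add g1 g2 _ _ i1 i2 =>
    intro η hη
    obtain ⟨h1, m1, l1⟩ := i1 (η / 2) (by positivity)
    obtain ⟨h2, m2, l2⟩ := i2 (η / 2) (by positivity)
    refine ⟨h1 + h2, (Net d).add_mem m1 m2, ?_⟩
    intro x y hx hy
    have a1 := l1 x y hx hy
    have a2 := l2 x y hx hy
    simp only [Pi.add_apply]
    rw [abs_le] at *
    constructor <;> linarith [a1.1, a1.2, a2.1, a2.2]
  | smul c g _ i =>
    intro η hη
    obtain ⟨h, m, l⟩ := i (η / (|c| + 1)) (by positivity)
    refine ⟨c • h, (Net d).smul_mem c m, ?_⟩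
    intro x y hx hy
    have a1 := l x y hx hy
    simp only [Pi.smul_apply, smul_eq_mul]
    rw [← mul_sub, ← mul_sub, ← mul_sub, abs_mul]
    calc _ ≤ (|c| + 1) * (η / (|c| + 1) * ‖x - y‖) := by gcongr; linarith
      _ = _ := by field_simp

lemma ExpSpan.one_mem {d : ℕ} : (1 : (Fin d → ℝ) → ℝ) ∈ ExpSpan d :=
  Submodule.subset_span ⟨0, by ext; simp⟩

lemma ExpSpan.mul_mem {d : ℕ} {f g : (Fin d → ℝ) → ℝ} (hf : f ∈ ExpSpan d) (hg : g ∈ ExpSpan d) :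
    f * g ∈ ExpSpan d := by
  have h := Submodule.mul_mem_mul hf hg
  unfold ExpSpan at h
  rw [Submodule.span_mul_span] at h
  refine Submodule.span_mono ?_ h
  rintro _ ⟨_, ⟨w, rfl⟩, _, ⟨v, rfl⟩, rfl⟩
  exact ⟨w + v, by ext x; simp [add_dotProduct, Real.exp_add]⟩

lemma ExpSpan.continuous {d : ℕ} {g : (Fin d → ℝ) → ℝ} (hg : g ∈ ExpSpan d) : Continuous g := by
  induction hg using Submodule.span_induction with
  | mem g hg => obtain ⟨w, rfl⟩ := hg; unfold dotProduct; fun_prop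
  | zero => exact continuous_const
  | add _ _ _ _ h1 h2 => exact h1.add h2
  | smul c _ _ h => exact h.const_smul c

open MeasureTheory in
lemma ExpSpan.conv {d : ℕ} {F : (Fin d → ℝ) → ℝ} (hF : Continuous F) (hFc : HasCompactSupport F)
    {g : (Fin d → ℝ) → ℝ} (hg : g ∈ ExpSpan d) :
    (fun x => ∫ y, F y * g (x - y)) ∈ ExpSpan d := by
  have hint : ∀ g ∈ ExpSpan d, ∀ x, Integrable fun y => F y * g (x - y) := by
    intro g hg x
    have := ExpSpan.continuous hg
    exact Continuous.integrable_of_hasCompactSupport (by fun_prop) hFc.mul_right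
  induction hg using Submodule.span_induction with
  | mem g hg =>
    obtain ⟨w, rfl⟩ := hg
    have : (fun x => ∫ y, F y * Real.exp (w ⬝ᵥ (x - y))) =
        (∫ y, F y * Real.exp (- (w ⬝ᵥ y))) • (fun x => Real.exp (w ⬝ᵥ x)) := by
      ext x
      simp only [Pi.smul_apply, smul_eq_mul]
      rw [← integral_mul_const]
      congr 1; ext y
      rw [dotProduct_sub, sub_eq_add_neg, Real.exp_add]; ring
    simp only [this]
    exact Submodule.smul_mem _ _ (Submodule.subset_span ⟨w, rfl⟩)
  | zero =>
    simp only [Pi.zero_apply, mul_zero, integral_zero]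
    exact (ExpSpan d).zero_mem
  | add g1 g2 m1 m2 h1 h2 =>
    convert (ExpSpan d).add_mem h1 h2 using 1
    ext x
    simp only [Pi.add_apply, mul_add]
    exact integral_add (hint g1 m1 x) (hint g2 m2 x)
  | smul c g _ h =>
    convert (ExpSpan d).smul_mem c h using 1
    ext x
    simp only [Pi.smul_apply, smul_eq_mul]
    rw [← integral_const_mul]
    congr 1; ext y; ring

lemma ExpSpan.dense {d : ℕ} (r : ℝ) {ρ : (Fin d → ℝ) → ℝ} (hρ : Continuous ρ) (η : ℝ) (hη : 0 < η) :
    ∃ q ∈ ExpSpan d, ∀ x, ‖x‖ ≤ r → |q x - ρ x| ≤ η := by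
  let X := Metric.closedBall (0 : Fin d → ℝ) r
  have : CompactSpace X := isCompact_iff_compactSpace.1 (isCompact_closedBall _ _)
  let A : Subalgebra ℝ C(X, ℝ) :=
    { carrier := {q | ∃ g ∈ ExpSpan d, ∀ x : X, q x = g x}
      mul_mem' := by
        rintro a b ⟨g, hg, h1⟩ ⟨k, hk, h2⟩
        exact ⟨g * k, ExpSpan.mul_mem hg hk, fun x => by simp [h1, h2]⟩
      add_mem' := by
        rintro a b ⟨g, hg, h1⟩ ⟨k, hk, h2⟩
        exact ⟨g + k, Submodule.add_mem _ hg hk, fun x => by simp [h1, h2]⟩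
      algebraMap_mem' := fun c =>
        ⟨c • 1, Submodule.smul_mem _ _ ExpSpan.one_mem, fun x => by simp⟩ }
  have hsep : A.SeparatesPoints := by
    intro x y hxy
    have : ∃ i, x.1 i ≠ y.1 i := by
      by_contra! h
      exact hxy (Subtype.ext (funext h))
    obtain ⟨i, hi⟩ := this
    refine ⟨fun z : X => Real.exp (z.1 i), ⟨⟨fun z : X => Real.exp (z.1 i),
      Real.continuous_exp.comp ((continuous_apply i).comp continuous_subtype_val)⟩, ?_, rfl⟩, ?_⟩
    · exact ⟨_, Submodule.subset_span ⟨Pi.single i 1, rfl⟩, fun x => by simp⟩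
    · simpa using hi
  obtain ⟨⟨q, g, hg, hq⟩, hqn⟩ :=
    ContinuousMap.exists_mem_subalgebra_near_continuousMap_of_separatesPoints A hsep
      ⟨fun z : X => ρ z, by fun_prop⟩ η hη
  refine ⟨g, hg, fun x hx => ?_⟩
  have := (ContinuousMap.norm_coe_le_norm _ (⟨x, by simpa [X] using hx⟩ : X)).trans hqn.le
  simpa [hq] using this

lemma IsNorm.neg {d : ℕ} {N : (Fin d → ℝ) → ℝ} (hN : IsNorm N) (x : Fin d → ℝ) : N (-x) = N x := by
  have := hN.2.1 (-1) x
  simpa using this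

lemma IsNorm.zero {d : ℕ} {N : (Fin d → ℝ) → ℝ} (hN : IsNorm N) : N 0 = 0 := (hN.1 0).2 rfl

lemma IsNorm.nonneg {d : ℕ} {N : (Fin d → ℝ) → ℝ} (hN : IsNorm N) (x : Fin d → ℝ) : 0 ≤ N x := by
  have h := hN.2.2 x (-x)
  rw [hN.neg, add_neg_cancel, hN.zero] at h
  linarith

lemma IsNorm.abs_sub_le {d : ℕ} {N : (Fin d → ℝ) → ℝ} (hN : IsNorm N) (x y : Fin d → ℝ) :
    |N x - N y| ≤ N (x - y) := by
  have h1 := hN.2.2 (x - y) y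
  have h2 := hN.2.2 (y - x) x
  rw [← neg_sub x y, hN.neg] at h2
  rw [neg_sub, sub_add_cancel] at h2
  rw [sub_add_cancel] at h1
  rw [abs_le]; constructor <;> linarith

lemma IsNorm.upper {d : ℕ} {N : (Fin d → ℝ) → ℝ} (hN : IsNorm N) :
    ∃ C > 0, ∀ x, N x ≤ C * ‖x‖ := by
  have hsum : ∀ (s : Finset (Fin d)) (g : Fin d → (Fin d → ℝ)), N (∑ i ∈ s, g i) ≤ ∑ i ∈ s, N (g i) := by
    intro s g
    exact Finset.le_sum_of_subadditive N hN.zero.le hN.2.2 s g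
  refine ⟨∑ i, N (Pi.single i 1) + 1, ?_, ?_⟩
  · have : 0 ≤ ∑ i, N (Pi.single i (1 : ℝ)) := Finset.sum_nonneg fun i _ => hN.nonneg _
    linarith
  · intro x
    have hx : x = ∑ i, x i • (Pi.single i (1 : ℝ) : Fin d → ℝ) := pi_eq_sum_univ' x
    calc N x = N (∑ i, x i • (Pi.single i (1 : ℝ) : Fin d → ℝ)) := by rw [← hx]
      _ ≤ ∑ i, N (x i • (Pi.single i (1 : ℝ) : Fin d → ℝ)) := hsum _ _
      _ ≤ ∑ i, N (Pi.single i (1 : ℝ)) * ‖x‖ := by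
        refine Finset.sum_le_sum fun i _ => ?_
        rw [hN.2.1, mul_comm]
        exact mul_le_mul_of_nonneg_left (norm_le_pi_norm x i) (hN.nonneg _)
      _ ≤ _ := by
        rw [← Finset.sum_mul]
        gcongr
        linarith

lemma IsNorm.lipCont {d : ℕ} {N : (Fin d → ℝ) → ℝ} (hN : IsNorm N) {L : ℝ} (hL : 0 < L)
    {F : (Fin d → ℝ) → ℝ} (hF : ∀ x y, |F x - F y| ≤ L * N (x - y)) : Continuous F := by
  obtain ⟨C, hC, h⟩ := hN.upper
  refine (LipschitzWith.of_dist_le_mul (K := ⟨L * C, by positivity⟩) fun x y => ?_).continuous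
  rw [Real.dist_eq, dist_eq_norm]
  refine (hF x y).trans ?_
  change L * N (x - y) ≤ L * C * ‖x - y‖
  rw [mul_assoc]
  exact mul_le_mul_of_nonneg_left (h _) hL.le

lemma IsNorm.lower {d : ℕ} {N : (Fin d → ℝ) → ℝ} (hN : IsNorm N) :
    ∃ c > 0, ∀ x, c * ‖x‖ ≤ N x := by
  have hcont : Continuous N := hN.lipCont one_pos (by simpa using hN.abs_sub_le)
  have hunit : ∀ x : Fin d → ℝ, x ≠ 0 → ‖x‖⁻¹ • x ∈ Metric.sphere (0 : Fin d → ℝ) 1 := by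
    intro x hx
    have := norm_pos_iff.2 hx
    simp [norm_smul, this.ne']
  rcases (Metric.sphere (0 : Fin d → ℝ) 1).eq_empty_or_nonempty with he | hne
  · refine ⟨1, one_pos, fun x => ?_⟩
    by_cases hx : x = 0
    · simp [hx, hN.zero]
    · have := hunit x hx
      rw [he] at this
      exact this.elim
  · obtain ⟨z, hz, hmin⟩ := (isCompact_sphere (0 : Fin d → ℝ) 1).exists_isMinOn hne hcont.continuousOn
    have hz0 : z ≠ 0 := by rintro rfl; simp at hz
    have hpos : 0 < N z := lt_of_le_of_ne (hN.nonneg z) fun h => hz0 ((hN.1 z).1 h.symm)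
    refine ⟨N z, hpos, fun x => ?_⟩
    by_cases hx : x = 0
    · simp [hx, hN.zero]
    · have h1 : N z ≤ N (‖x‖⁻¹ • x) := hmin (hunit x hx)
      have hxp := norm_pos_iff.2 hx
      rw [hN.2.1, abs_of_pos (by positivity)] at h1
      calc N z * ‖x‖ ≤ (‖x‖⁻¹ * N x) * ‖x‖ := by gcongr
        _ = N x := by field_simp

lemma IsNorm.extend {d : ℕ} {N : (Fin d → ℝ) → ℝ} (hN : IsNorm N)
    {K : Set (Fin d → ℝ)} (hK : Bornology.IsBounded K) (hne : K.Nonempty)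
    {L : ℝ} (hL : 0 < L) {f : (Fin d → ℝ) → ℝ}
    (hf : ∀ x ∈ K, ∀ y ∈ K, |f x - f y| ≤ L * N (x - y)) :
    ∃ (F : (Fin d → ℝ) → ℝ) (M R' : ℝ), 0 ≤ M ∧ 0 ≤ R' ∧ (∀ x y, |F x - F y| ≤ L * N (x - y)) ∧
      (∀ x ∈ K, F x = f x) ∧ (∀ x, |F x| ≤ M) ∧ (∀ x, R' < ‖x‖ → F x = 0) := by
  obtain ⟨C, hC, hCN⟩ := hN.upper
  obtain ⟨c, hc, hcN⟩ := hN.lower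
  obtain ⟨R, hR0, hR⟩ := hK.exists_pos_norm_le
  obtain ⟨x0, hx0⟩ := hne
  have : Nonempty K := ⟨⟨x0, hx0⟩⟩
  have hKN : ∀ x ∈ K, N x ≤ C * R := fun x hx => (hCN x).trans (by gcongr; exact hR x hx)
  obtain ⟨M, hM0, hM⟩ : ∃ M ≥ 0, ∀ x ∈ K, |f x| ≤ M := by
    refine ⟨|f x0| + L * (C * (R + R)), by positivity, fun x hx => ?_⟩
    have h1 := hf x hx x0 hx0
    have h2 : L * N (x - x0) ≤ L * (C * (R + R)) := by
      gcongr
      refine (hCN _).trans ?_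
      gcongr
      exact (norm_sub_le _ _).trans (add_le_add (hR x hx) (hR x0 hx0))
    have h3 := abs_sub_abs_le_abs_sub (f x) (f x0)
    linarith
  let F0 : (Fin d → ℝ) → ℝ := fun x => ⨅ y : K, (f y + L * N (x - y))
  have hbdd : ∀ x, BddBelow (Set.range fun y : K => f y + L * N (x - y)) := by
    intro x
    refine ⟨-M, ?_⟩
    rintro _ ⟨y, rfl⟩
    have h1 := (abs_le.1 (hM y y.2)).1
    have h2 := mul_nonneg hL.le (hN.nonneg (x - y))
    simp only; linarith
  have hF0le : ∀ x y, F0 x ≤ F0 y + L * N (x - y) := by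
    intro x y
    rw [← sub_le_iff_le_add]
    refine le_ciInf fun z => ?_
    rw [sub_le_iff_le_add]
    refine (ciInf_le (hbdd x) z).trans ?_
    have h := hN.2.2 (x - y) (y - z)
    rw [sub_add_sub_cancel] at h
    nlinarith
  have hsymm : ∀ x y, N (x - y) = N (y - x) := fun x y => by rw [← hN.neg, neg_sub]
  have hF0 : ∀ x y, |F0 x - F0 y| ≤ L * N (x - y) := by
    intro x y
    have h1 := hF0le x y
    have h2 := hF0le y x
    rw [hsymm y x] at h2
    rw [abs_le]; constructor <;> linarith
  have hF0K : ∀ x ∈ K, F0 x = f x := by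
    intro x hx
    apply le_antisymm
    · refine (ciInf_le (hbdd x) ⟨x, hx⟩).trans ?_
      simp [hN.zero]
    · refine le_ciInf fun y => ?_
      have := (abs_le.1 (hf x hx y y.2)).2
      linarith
  let u : (Fin d → ℝ) → ℝ := fun x => max 0 (M + L * (C * R) - L * N x)
  have hu0 : ∀ x, 0 ≤ u x := fun x => le_max_left _ _
  have hu : ∀ x y, |u x - u y| ≤ L * N (x - y) := by
    intro x y
    refine (abs_max_sub_max_le_max _ _ _ _).trans ?_
    have h0 := mul_nonneg hL.le (hN.nonneg (x - y))
    refine max_le (by simpa using h0) ?_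
    have h1 := abs_le.1 (hN.abs_sub_le x y)
    rw [abs_le]; constructor <;> nlinarith [h1.1, h1.2]
  have huM : ∀ x, u x ≤ M + L * (C * R) := by
    intro x
    have h0 := mul_nonneg hL.le (hN.nonneg x)
    exact max_le (by positivity) (by linarith)
  refine ⟨fun x => max (-u x) (min (u x) (F0 x)), M + L * (C * R), (M + L * (C * R)) / (L * c),
    by positivity, by positivity, ?_, ?_, ?_, ?_⟩
  · intro x y
    refine (abs_max_sub_max_le_max _ _ _ _).trans (max_le ?_ ?_)
    · have := hu x y
      rw [abs_sub_comm] at this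
      rwa [neg_sub_neg]
    · exact (abs_min_sub_min_le_max _ _ _ _).trans (max_le (hu x y) (hF0 x y))
  · intro x hx
    have h1 : M ≤ u x := by
      refine le_trans ?_ (le_max_right _ _)
      have := mul_le_mul_of_nonneg_left (hKN x hx) hL.le
      linarith
    have h2 := abs_le.1 (hM x hx)
    simp only
    rw [hF0K x hx, min_eq_right (by linarith), max_eq_right (by linarith)]
  · intro x
    have := huM x
    have := hu0 x
    rw [abs_le]
    refine ⟨le_trans (by linarith) (le_max_left _ _), max_le (by linarith) ?_⟩
    exact (min_le_left _ _).trans (huM x)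
  · intro x hx
    have : u x = 0 := by
      apply max_eq_left
      rw [div_lt_iff₀ (by positivity)] at hx
      have := mul_le_mul_of_nonneg_left (hcN x) hL.le
      linarith
    simp [this]

open MeasureTheory in
lemma IsNorm.key {d : ℕ} {N : (Fin d → ℝ) → ℝ} (hN : IsNorm N) {L : ℝ} (hL : 0 < L)
    {F : (Fin d → ℝ) → ℝ} {M R' : ℝ} (hM : 0 ≤ M) (hR' : 0 ≤ R')
    (hF : ∀ x y, |F x - F y| ≤ L * N (x - y)) (hFM : ∀ x, |F x| ≤ M)
    (hF0 : ∀ x, R' < ‖x‖ → F x = 0) {R : ℝ} (hR : 0 ≤ R) {θ : ℝ} (hθ : 0 < θ) :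
    ∃ H ∈ ExpSpan d, (∀ x y, ‖x‖ ≤ R → ‖y‖ ≤ R → |H x - H y| ≤ (L + θ) * N (x - y)) ∧
      ∀ x, ‖x‖ ≤ R → |H x - F x| ≤ θ := by
  obtain ⟨C, hC, hCN⟩ := hN.upper
  have hFc : Continuous F := hN.lipCont hL hF
  have hFs : HasCompactSupport F := by
    refine HasCompactSupport.of_support_subset_isCompact (isCompact_closedBall (0 : Fin d → ℝ) R') ?_
    intro x hx
    by_contra h
    exact hx (hF0 x (by simpa using h))
  set X := Metric.closedBall (0 : Fin d → ℝ) (R + R' + 1) with hX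
  set V := volume.real X with hV
  have hV0 : 0 ≤ V := measureReal_nonneg
  have hXc : IsCompact X := isCompact_closedBall _ _
  have hXm : MeasurableSet X := measurableSet_closedBall
  obtain ⟨δ, hδ, hδ1, hδ2⟩ : ∃ δ > 0, δ ≤ 1 ∧ L * C * δ ≤ θ / 2 := by
    refine ⟨min 1 (θ / 2 / (L * C)), by positivity, min_le_left _ _, ?_⟩
    calc _ ≤ L * C * (θ / 2 / (L * C)) := by gcongr; exact min_le_right _ _
      _ = _ := by field_simp
  obtain ⟨η, hη, hη1, hη2⟩ : ∃ η > 0, L * (η * V) ≤ θ ∧ M * (η * V) ≤ θ / 2 := by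
    refine ⟨θ / (2 * ((L + M + 1) * (V + 1))), by positivity, ?_, ?_⟩
    · rw [div_mul_eq_mul_div, mul_div_assoc', div_le_iff₀ (by positivity)]
      have : L * V ≤ (L + M + 1) * (V + 1) := by gcongr <;> linarith
      nlinarith [mul_nonneg hL.le hV0]
    · rw [div_mul_eq_mul_div, mul_div_assoc', div_le_iff₀ (by positivity)]
      have : M * V ≤ (L + M + 1) * (V + 1) := by gcongr <;> linarith
      nlinarith
  let φ : ContDiffBump (0 : Fin d → ℝ) := ⟨δ / 2, δ, by positivity, by linarith⟩
  set ρ : (Fin d → ℝ) → ℝ := φ.normed volume with hρ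
  have hρc : Continuous ρ := φ.continuous_normed
  have hρ0 : ∀ t, 0 ≤ ρ t := fun t => φ.nonneg_normed t
  have hρs : ∀ t, δ ≤ ‖t‖ → ρ t = 0 := by
    intro t ht
    have : t ∉ Function.support ρ := by
      rw [hρ, φ.support_normed_eq]
      simpa [φ] using ht
    simpa using this
  have hρ1 : ∫ t in X, ρ t = 1 := by
    rw [setIntegral_eq_integral_of_forall_compl_eq_zero, φ.integral_normed]
    intro t ht
    apply hρs
    simp [hX] at ht
    linarith
  obtain ⟨q, hq, hqρ⟩ := ExpSpan.dense (R + R' + 1) hρc η hη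
  have hqc := ExpSpan.continuous hq
  have hH : ∀ x, ‖x‖ ≤ R → ∫ y, F y * q (x - y) = ∫ t in X, F (x - t) * q t := by
    intro x hx
    rw [setIntegral_eq_integral_of_forall_compl_eq_zero,
      ← integral_sub_left_eq_self (fun y => F y * q (x - y)) volume x]
    · simp
    · intro t ht
      simp [hX] at ht
      rw [hF0, zero_mul]
      have := norm_sub_norm_le t x
      rw [norm_sub_rev] at this
      linarith
  have hintc : ∀ g : (Fin d → ℝ) → ℝ, Continuous g → IntegrableOn g X volume :=
    fun g hg => hg.continuousOn.integrableOn_compact hXc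
  have hqX : ∀ t ∈ X, |q t - ρ t| ≤ η := fun t ht => hqρ t (by simpa [hX] using ht)
  refine ⟨_, ExpSpan.conv hFc hFs hq, ?_, ?_⟩
  · intro x y hx hy
    rw [hH x hx, hH y hy, ← integral_sub (hintc _ (by fun_prop)) (hintc _ (by fun_prop))]
    have hb : ∀ᵐ t ∂(volume.restrict X), ‖F (x - t) * q t - F (y - t) * q t‖ ≤
        L * N (x - y) * (ρ t + η) := by
      refine ae_restrict_of_forall_mem hXm fun t ht => ?_
      rw [← sub_mul, norm_mul, Real.norm_eq_abs, Real.norm_eq_abs]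
      have h1 := hF (x - t) (y - t)
      rw [sub_sub_sub_cancel_right] at h1
      have h2 : |q t| ≤ ρ t + η := by
        have := abs_le.1 (hqX t ht)
        have := hρ0 t
        rw [abs_le]; constructor <;> linarith
      exact mul_le_mul h1 h2 (abs_nonneg _) (mul_nonneg hL.le (hN.nonneg _))
    have h := norm_integral_le_of_norm_le (hintc _ (by fun_prop)) hb
    rw [integral_const_mul, integral_add (hintc _ hρc) (hintc _ continuous_const), hρ1,
      setIntegral_const, smul_eq_mul, Real.norm_eq_abs] at h
    refine h.trans ?_
    have := hN.nonneg (x - y)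
    nlinarith [mul_le_mul_of_nonneg_right hη1 this]
  · intro x hx
    have hFx : F x = ∫ t in X, F x * ρ t := by rw [integral_const_mul, hρ1, mul_one]
    rw [hH x hx, hFx, ← integral_sub (hintc _ (by fun_prop)) (hintc _ (by fun_prop))]
    have hb : ∀ᵐ t ∂(volume.restrict X), ‖F (x - t) * q t - F x * ρ t‖ ≤
        M * η + L * C * δ * ρ t := by
      refine ae_restrict_of_forall_mem hXm fun t ht => ?_
      have e : F (x - t) * q t - F x * ρ t =
        F (x - t) * (q t - ρ t) + (F (x - t) - F x) * ρ t := by ring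
      rw [e]
      refine (norm_add_le _ _).trans (add_le_add ?_ ?_)
      · rw [norm_mul]
        exact mul_le_mul (hFM _) (hqX t ht) (abs_nonneg _) hM
      · rcases le_or_gt δ ‖t‖ with h | h
        · simp [hρs t h]
        · rw [norm_mul, Real.norm_eq_abs, Real.norm_eq_abs, abs_of_nonneg (hρ0 t)]
          refine mul_le_mul_of_nonneg_right ((hF _ _).trans ?_) (hρ0 t)
          rw [sub_sub_cancel_left, hN.neg, mul_assoc]
          refine mul_le_mul_of_nonneg_left ((hCN t).trans ?_) hL.le
          gcongr
    have h := norm_integral_le_of_norm_le (hintc _ (by fun_prop)) hb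
    rw [integral_add (hintc _ continuous_const) (hintc _ (by fun_prop)), setIntegral_const,
      integral_const_mul, hρ1, smul_eq_mul, Real.norm_eq_abs] at h
    refine h.trans ?_
    linarith

/-- Main theorem for the ReLU activation, network size depending on `f`:
every `L`-Lipschitz function on a bounded set `K` can be uniformly approximated
on `K` by an `L`-Lipschitz one-hidden-layer ReLU network. -/
theorem stmt14 {d : ℕ} (N : (Fin d → ℝ) → ℝ) (hN : IsNorm N)
    (K : Set (Fin d → ℝ)) (hK : Bornology.IsBounded K)
    (L : ℝ) (hL : 0 < L) (ε : ℝ) (hε : 0 < ε)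
    (f : (Fin d → ℝ) → ℝ)
    (hf : ∀ x ∈ K, ∀ y ∈ K, |f x - f y| ≤ L * N (x - y)) :
    ∃ (m : ℕ) (b : ℝ) (a c : Fin m → ℝ) (w : Fin m → Fin d → ℝ),
      ∃ fm : (Fin d → ℝ) → ℝ,
        fm = (fun x => b + ∑ i, a i * max 0 (∑ j, w i j * x j + c i)) ∧
        (∀ x ∈ K, ∀ y ∈ K, |fm x - fm y| ≤ L * N (x - y)) ∧
        (∀ x ∈ K, |f x - fm x| ≤ ε) := by
  suffices h : ∃ fm ∈ Net d, (∀ x ∈ K, ∀ y ∈ K, |fm x - fm y| ≤ L * N (x - y)) ∧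
        (∀ x ∈ K, |f x - fm x| ≤ ε) by
    obtain ⟨fm, ⟨m, b, a, c, w, e⟩, h1, h2⟩ := h
    exact ⟨m, b, a, c, w, fm, e, h1, h2⟩
  rcases K.eq_empty_or_nonempty with rfl | hne
  · exact ⟨0, (Net d).zero_mem, by simp, by simp⟩
  obtain ⟨F, M, R', hM, hR', hF, hFf, hFM, hF0⟩ := hN.extend hK hne hL hf
  obtain ⟨R, hR0, hR⟩ := hK.exists_pos_norm_le
  obtain ⟨c, hc, hcN⟩ := hN.lower
  have main : ∀ θ > 0, ∃ h ∈ Net d, (∀ x ∈ K, ∀ y ∈ K, |h x - h y| ≤ (L + θ) * N (x - y)) ∧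
        (∀ x ∈ K, |f x - h x| ≤ θ) := by
    intro θ hθ
    obtain ⟨H, hH, hl, hs⟩ := hN.key hL hM hR' hF hFM hF0 hR0.le (half_pos hθ)
    obtain ⟨η, hη, hη1, hη2⟩ : ∃ η > 0, η ≤ θ / 2 * c ∧ η * R ≤ θ / 2 := by
      refine ⟨min (θ / 2 * c) (θ / 2 / R), by positivity, min_le_left _ _, ?_⟩
      calc _ ≤ θ / 2 / R * R := by gcongr; exact min_le_right _ _
        _ = _ := by field_simp
    obtain ⟨h, hmem, hap⟩ := ExpSpan.approx R hH η hη
    refine ⟨h + fun _ => H 0 - h 0, (Net d).add_mem hmem (Net.const_mem _), ?_, ?_⟩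
    · intro x hx y hy
      have h1 := hl x y (hR x hx) (hR y hy)
      have h2 := hap x y (hR x hx) (hR y hy)
      have h3 : η * ‖x - y‖ ≤ θ / 2 * N (x - y) :=
        calc η * ‖x - y‖ ≤ θ / 2 * c * ‖x - y‖ := by gcongr
          _ = θ / 2 * (c * ‖x - y‖) := by ring
          _ ≤ _ := by gcongr; exact hcN _
      simp only [Pi.add_apply]
      rw [abs_le] at *
      constructor <;> linarith [h1.1, h1.2, h2.1, h2.2]
    · intro x hx
      have h1 := hs x (hR x hx)
      have h2 := hap x 0 (hR x hx) (by simpa using hR0.le)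
      have h3 : η * ‖x - 0‖ ≤ θ / 2 := by
        rw [sub_zero]
        exact (mul_le_mul_of_nonneg_left (hR x hx) hη.le).trans hη2
      rw [hFf x hx] at h1
      simp only [Pi.add_apply]
      rw [abs_le] at *
      constructor <;> linarith [h1.1, h1.2, h2.1, h2.2]
  obtain ⟨θ, hθ, hθ1, hθ2⟩ : ∃ θ > 0, θ ≤ 1 ∧ θ * (1 + (M + 1) / L) ≤ ε := by
    refine ⟨min 1 (ε / (1 + (M + 1) / L)), by positivity, min_le_left _ _, ?_⟩
    calc _ ≤ ε / (1 + (M + 1) / L) * (1 + (M + 1) / L) := by gcongr; exact min_le_right _ _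
      _ = _ := by field_simp
  obtain ⟨h, hmem, hl, hs⟩ := main θ hθ
  refine ⟨(L / (L + θ)) • h, (Net d).smul_mem _ hmem, ?_, ?_⟩
  · intro x hx y hy
    simp only [Pi.smul_apply, smul_eq_mul]
    rw [← mul_sub, abs_mul, abs_of_pos (by positivity)]
    calc _ ≤ L / (L + θ) * ((L + θ) * N (x - y)) := by gcongr; exact hl x hx y hy
      _ = _ := by field_simp
  · intro x hx
    simp only [Pi.smul_apply, smul_eq_mul]
    have h1 := hs x hx
    have h2 := hFM x
    rw [hFf x hx] at h2
    have h3 : |h x| ≤ M + 1 := by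
      rw [abs_le] at *
      constructor <;> linarith [h1.1, h1.2, h2.1, h2.2]
    have e : f x - L / (L + θ) * h x = (f x - h x) + θ / (L + θ) * h x := by
      field_simp; ring
    rw [e]
    refine (abs_add_le _ _).trans (le_trans ?_ hθ2)
    rw [mul_add, mul_one]
    refine add_le_add h1 ?_
    rw [abs_mul, abs_of_pos (by positivity)]
    calc θ / (L + θ) * |h x| ≤ θ / L * (M + 1) := by gcongr; linarith
      _ = _ := by ring
end

section
/- Let K ⊆ ℝ^d be a bounded set, L > 0, and ‖·‖ a norm on ℝ^d. Fix an activation φ that is C¹ and not a polynomial. Then for every ε > 0 there exists m = m(ε) ∈ ℕ such that for every f : ℝ^d → ℝ that is L-Lipschitz on K, there exists a one-hidden-layer network f_m of width m with activation φ that is L-Lipschitz on K and satisfies sup_{x ∈ K} |f(x) − f_m(x)| ≤ ε. In other words, sup_{f ∈ Lip_{L,K}} inf_{f_m ∈ Lip_{L,K} ∩ N^m} ‖f − f_m‖_{∞,K} ≤ ε. -/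
open Finset

lemma exists_antideriv_poly (k : ℕ) (p : Polynomial ℝ) (hp : p.degree < k) :
    ∃ q : Polynomial ℝ, q.derivative = p ∧ q.degree < (k + 1 : ℕ) := by
  rcases Nat.eq_zero_or_pos k with rfl | hk
  · have : p = 0 := by simpa using hp
    exact ⟨0, by simp [this], by simp⟩
  refine ⟨∑ i ∈ Finset.range k, Polynomial.monomial (i + 1) (p.coeff i / (i + 1)), ?_, ?_⟩
  · rw [Polynomial.derivative_sum]
    conv_rhs => rw [p.as_sum_range' k (by
      by_cases h : p = 0
      · subst h
        simpa using hk
      · exact (Polynomial.natDegree_lt_iff_degree_lt h).2 hp)]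
    refine Finset.sum_congr rfl fun i _ => ?_
    rw [Polynomial.derivative_monomial]
    have : (i : ℝ) + 1 ≠ 0 := by positivity
    simp only [Nat.add_sub_cancel]
    congr 1
    push_cast
    field_simp
  · refine (Polynomial.degree_sum_le _ _).trans_lt ?_
    rw [Finset.sup_lt_iff (by exact_mod_cast WithBot.bot_lt_coe _)]
    intro i hi
    refine (Polynomial.degree_monomial_le _ _).trans_lt ?_
    have := Finset.mem_range.1 hi
    exact_mod_cast (by omega : i + 1 < k + 1)

lemma eq_poly_of_deriv {g : ℝ → ℝ} (hg : Differentiable ℝ g) {k : ℕ} {p : Polynomial ℝ}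
    (hp : p.degree < k) (h : ∀ x, deriv g x = p.eval x) :
    ∃ q : Polynomial ℝ, q.degree < (k + 1 : ℕ) ∧ ∀ x, g x = q.eval x := by
  obtain ⟨q, hq, hd⟩ := exists_antideriv_poly k p hp
  have hc : ∀ x y, (fun x => g x - q.eval x) x = (fun x => g x - q.eval x) y := by
    apply is_const_of_deriv_eq_zero
    · exact hg.sub q.differentiable
    · intro x
      rw [deriv_fun_sub (hg x) q.differentiableAt, h, Polynomial.deriv, hq, sub_self]
  refine ⟨q + Polynomial.C (g 0 - q.eval 0), ?_, fun x => ?_⟩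
  · refine (Polynomial.degree_add_le _ _).trans_lt (max_lt hd ?_)
    refine Polynomial.degree_C_le.trans_lt ?_
    exact_mod_cast Nat.succ_pos k
  · have := hc x 0
    simp at this ⊢
    linarith

lemma eq_poly_of_iteratedDeriv (k : ℕ) : ∀ (g : ℝ → ℝ), ContDiff ℝ (⊤ : ℕ∞) g →
    (∀ x, iteratedDeriv k g x = 0) →
    ∃ q : Polynomial ℝ, q.degree < k ∧ ∀ x, g x = q.eval x := by
  induction k with
  | zero =>
    intro g _ h
    exact ⟨0, by simp, fun x => by simpa using h x⟩
  | succ k ih =>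
    intro g hg h
    have hg1 : ContDiff ℝ (⊤ : ℕ∞) (deriv g) := (contDiff_infty_iff_deriv.1 hg).2
    obtain ⟨p, hp, hpe⟩ := ih (deriv g) hg1 (fun x => by rw [← iteratedDeriv_succ']; exact h x)
    exact eq_poly_of_deriv (contDiff_infty_iff_deriv.1 hg).1 hp hpe

lemma poly_of_tendsto (k : ℕ) (u : ℕ → ℝ → ℝ) (σ : ℝ → ℝ)
    (hu : ∀ n, ∃ q : Polynomial ℝ, q.degree < k ∧ ∀ x, u n x = q.eval x)
    (hl : ∀ x, Filter.Tendsto (fun n => u n x) Filter.atTop (nhds (σ x))) :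
    ∃ q : Polynomial ℝ, ∀ x, σ x = q.eval x := by
  have hinj : Set.InjOn (fun i : ℕ => (i : ℝ)) (Finset.range k : Finset ℕ) :=
    Nat.cast_injective.injOn
  refine ⟨Lagrange.interpolate (Finset.range k) (fun i : ℕ => (i : ℝ)) (fun i => σ i), fun x => ?_⟩
  have h1 : ∀ n, u n x = ∑ i ∈ Finset.range k,
      u n i * (Lagrange.basis (Finset.range k) (fun i : ℕ => (i : ℝ)) i).eval x := by
    intro n
    obtain ⟨q, hq, hqe⟩ := hu n
    have := Lagrange.eq_interpolate (f := q) hinj (by simpa using hq)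
    rw [hqe x]
    conv_lhs => rw [this]
    simp [Lagrange.interpolate_apply, Polynomial.eval_finsetSum, hqe]
  refine tendsto_nhds_unique (hl x) ?_
  simp only [Lagrange.interpolate_apply, Polynomial.eval_finsetSum, Polynomial.eval_mul,
    Polynomial.eval_C]
  rw [funext h1]
  exact tendsto_finsetSum _ fun i _ => (hl i).mul_const _

/-- An integral of a continuous compactly supported curve in a closed subspace is in it. -/
lemma integral_mem_closed {E : Type*} [NormedAddCommGroup E] [NormedSpace ℝ E] [CompleteSpace E]
    (V : Submodule ℝ E) (hV : IsClosed (V : Set E)) (f : ℝ → E) (hf : Continuous f)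
    (hs : HasCompactSupport f) (hm : ∀ s, f s ∈ V) : ∫ s, f s ∈ V := by
  have : CompleteSpace V := hV.completeSpace_coe
  let f' : ℝ → V := fun s => ⟨f s, hm s⟩
  have hc : Continuous f' := hf.subtype_mk _
  have hs' : HasCompactSupport f' := by
    refine hs.mono ?_
    intro s hs
    simp only [Function.mem_support] at hs ⊢
    intro h
    exact hs (Subtype.ext h)
  have := V.subtypeL.integral_comp_comm (hc.integrable_of_hasCompactSupport hs' (μ := MeasureTheory.volume))
  have h2 : ∫ s, f s = V.subtypeL (∫ s, f' s) := this
  rw [h2]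
  exact (∫ s, f' s).2

/-- the curve of functions on `[-R,R]` -/
def curveOf (R : ℝ) (G : ℝ → ℝ → ℝ) (hG : Continuous (Function.uncurry G)) (s : ℝ) :
    C(Set.Icc (-R) R, ℝ) :=
  ⟨fun t => G s t, by
    exact hG.comp (by fun_prop : Continuous fun t : Set.Icc (-R) R => (s, (t : ℝ)))⟩

lemma curveOf_apply (R : ℝ) (G : ℝ → ℝ → ℝ) (hG : Continuous (Function.uncurry G)) (s : ℝ)
    (t : Set.Icc (-R) R) : curveOf R G hG s t = G s t := rfl

lemma continuous_curveOf (R : ℝ) (G : ℝ → ℝ → ℝ) (hG : Continuous (Function.uncurry G)) :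
    Continuous (curveOf R G hG) := by
  apply ContinuousMap.continuous_of_continuous_uncurry
  exact hG.comp (by fun_prop : Continuous fun p : ℝ × Set.Icc (-R) R => (p.1, (p.2 : ℝ)))

lemma hasDerivAt_curveOf (R : ℝ) (G G' : ℝ → ℝ → ℝ) (hG : Continuous (Function.uncurry G))
    (hG' : Continuous (Function.uncurry G')) (hd : ∀ s t, HasDerivAt (fun s => G s t) (G' s t) s)
    (s : ℝ) : HasDerivAt (curveOf R G hG) (curveOf R G' hG' s) s := by
  have hc := continuous_curveOf R G' hG'
  have h1 : curveOf R G hG = fun s => curveOf R G hG 0 + ∫ r in (0:ℝ)..s, curveOf R G' hG' r := by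
    funext s
    ext t
    let ev : C(Set.Icc (-R) R, ℝ) →L[ℝ] ℝ := ContinuousMap.evalCLM ℝ t
    have h2 := ev.intervalIntegral_comp_comm (hc.intervalIntegrable 0 s (μ := MeasureTheory.volume))
    have h3 : (∫ r in (0:ℝ)..s, curveOf R G' hG' r) t = ∫ r in (0:ℝ)..s, G' r t := h2.symm
    rw [ContinuousMap.add_apply, h3, intervalIntegral.integral_eq_sub_of_hasDerivAt
      (fun r _ => hd r t)]
    · simp [curveOf_apply]
    · apply Continuous.intervalIntegrable
      exact hG'.comp (by fun_prop : Continuous fun r : ℝ => (r, (t : ℝ)))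
  rw [h1]
  exact (intervalIntegral.integral_hasDerivAt_right (hc.intervalIntegrable _ _)
    (hc.stronglyMeasurableAtFilter _ _) hc.continuousAt).const_add _

lemma deriv_mem_closed {E : Type*} [NormedAddCommGroup E] [NormedSpace ℝ E]
    (V : Submodule ℝ E) (hV : IsClosed (V : Set E)) (f : ℝ → E) (hm : ∀ s, f s ∈ V)
    (f' : E) (s : ℝ) (h : HasDerivAt f f' s) : f' ∈ V := by
  have h1 := range_deriv_subset_closure_span_image f (dense_univ) (Set.mem_range_self s)
  rw [h.deriv] at h1
  have : closure ((Submodule.span ℝ (f '' Set.univ) : Submodule ℝ E) : Set E) ⊆ V := by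
    refine closure_minimal ?_ hV
    have : Submodule.span ℝ (f '' Set.univ) ≤ V := by
      rw [Submodule.span_le]
      rintro _ ⟨s, -, rfl⟩
      exact hm s
    exact this
  exact this h1

lemma cont_aff {σ : ℝ → ℝ} (hσ : Continuous σ) (c : ℝ) (k : ℕ) :
    Continuous (Function.uncurry fun w t : ℝ => t ^ k * σ (w * t + c)) := by
  unfold Function.uncurry
  fun_prop

/-- density of one-dimensional ridge functions (Leshno–Lin–Pinkus–Schocken) -/
lemma span_dense (R : ℝ) (σ : ℝ → ℝ) (hσ : Continuous σ)
    (hnp : ¬∃ p : Polynomial ℝ, ∀ x, σ x = p.eval x) :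
    (Submodule.span ℝ {g : C(Set.Icc (-R) R, ℝ) | ∃ w c : ℝ, w ≠ 0 ∧
      ∀ t, g t = σ (w * t + c)}).topologicalClosure = ⊤ := by
  set V := (Submodule.span ℝ {g : C(Set.Icc (-R) R, ℝ) | ∃ w c : ℝ, w ≠ 0 ∧
      ∀ t, g t = σ (w * t + c)}).topologicalClosure with hVdef
  have hV : IsClosed (V : Set C(Set.Icc (-R) R, ℝ)) := Submodule.isClosed_topologicalClosure _
  have gen : ∀ c w, curveOf R _ (cont_aff hσ c 0) w ∈ V := by
    intro c
    have hcl : IsClosed {w | curveOf R _ (cont_aff hσ c 0) w ∈ V} :=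
      hV.preimage (continuous_curveOf R _ (cont_aff hσ c 0))
    have hd : Dense {w : ℝ | w ≠ 0} := by
      exact dense_compl_singleton 0
    have hsub : {w : ℝ | w ≠ 0} ⊆ {w | curveOf R _ (cont_aff hσ c 0) w ∈ V} := by
      intro w hw
      apply Submodule.le_topologicalClosure
      apply Submodule.subset_span
      exact ⟨w, c, hw, fun t => by simp [curveOf_apply]⟩
    have := hcl.closure_subset_iff.2 hsub
    rw [hd.closure_eq] at this
    exact fun w => this (Set.mem_univ w)
  have mono : ∀ k : ℕ, curveOf R (fun _ t => t ^ k) (by unfold Function.uncurry; fun_prop) 0 ∈ V := by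
    by_contra hcon
    push Not at hcon
    obtain ⟨k, hk⟩ := hcon
    apply hnp
    let B : ℕ → ContDiffBump (0 : ℝ) := fun n =>
      ⟨1 / ((n : ℝ) + 1) / 2, 1 / ((n : ℝ) + 1), by positivity, by
        have : (0 : ℝ) < 1 / ((n : ℝ) + 1) := by positivity
        linarith⟩
    let u : ℕ → ℝ → ℝ := fun n =>
      MeasureTheory.convolution ((B n).normed MeasureTheory.volume) σ
        (ContinuousLinearMap.lsmul ℝ ℝ) MeasureTheory.volume
    refine poly_of_tendsto k u σ (fun n => ?_) (fun x => ?_)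
    · have hsm : ContDiff ℝ (⊤ : ℕ∞) (u n) :=
        (B n).hasCompactSupport_normed.contDiff_convolution_left _ (B n).contDiff_normed
          hσ.locallyIntegrable
      apply eq_poly_of_iteratedDeriv k (u n) hsm
      have hcd : ∀ j, Continuous (iteratedDeriv j (u n)) := fun j =>
        hsm.continuous_iteratedDeriv j (by exact_mod_cast le_top)
      have step : ∀ c j w, curveOf R _ (cont_aff (hcd j) c j) w ∈ V := by
        intro c j
        induction j with
        | zero =>
          intro w
          have hGc : Continuous (Function.uncurry fun s t : ℝ =>
              (B n).normed MeasureTheory.volume s * σ (w * t + c - s)) := by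
            have := (B n).continuous_normed (μ := MeasureTheory.volume)
            unfold Function.uncurry
            fun_prop
          have hcs : HasCompactSupport (curveOf R _ hGc) := by
            refine ((B n).hasCompactSupport_normed (μ := MeasureTheory.volume)).mono ?_
            intro s hs
            simp only [Function.mem_support] at hs ⊢
            intro h
            apply hs
            ext t
            simp [curveOf_apply, h]
          have hIntg := integral_mem_closed V hV _ (continuous_curveOf R _ hGc) hcs (fun s => by
            have h1 := V.smul_mem ((B n).normed MeasureTheory.volume s) (gen (c - s) w)
            convert h1 using 1
            ext t
            simp [curveOf_apply]
            left
            congr 1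
            ring)
          convert hIntg using 1
          ext t
          let ev : C(Set.Icc (-R) R, ℝ) →L[ℝ] ℝ := ContinuousMap.evalCLM ℝ t
          have h2 := ev.integral_comp_comm ((continuous_curveOf R _ hGc).integrable_of_hasCompactSupport
            hcs (μ := MeasureTheory.volume))
          refine Eq.trans ?_ h2
          simp [curveOf_apply, u, MeasureTheory.convolution, ev, ContinuousMap.evalCLM]
        | succ j ih =>
          intro w
          refine deriv_mem_closed V hV _ ih _ w (hasDerivAt_curveOf R _ _ _ _ ?_ w)
          intro s t
          have h1 : HasDerivAt (iteratedDeriv j (u n)) (iteratedDeriv (j + 1) (u n) (s * t + c))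
              (s * t + c) := by
            rw [iteratedDeriv_succ]
            apply DifferentiableAt.hasDerivAt
            exact (hsm.differentiable_iteratedDeriv j (by exact_mod_cast WithTop.coe_lt_top _)) _
          have h2 : HasDerivAt (fun s : ℝ => s * t + c) t s := by
            simpa using ((hasDerivAt_id s).mul_const t).add_const c
          have h3 := (h1.comp s h2).const_mul (t ^ j)
          exact h3.congr_deriv (by ring)
      intro c
      by_contra hne
      apply hk
      have h1 := V.smul_mem (iteratedDeriv k (u n) c)⁻¹ (step c k 0)
      convert h1 using 1
      ext t
      simp [curveOf_apply]
      field_simp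
    · apply ContDiffBump.convolution_tendsto_right_of_continuous _ hσ
      exact tendsto_one_div_add_atTop_nhds_zero_nat
  rw [eq_top_iff]
  have hp := polynomialFunctions_closure_eq_top (-R) R
  intro g _
  have hg : g ∈ (polynomialFunctions (Set.Icc (-R) R)).topologicalClosure := by
    rw [hp]; trivial
  have : ((polynomialFunctions (Set.Icc (-R) R)) : Set C(Set.Icc (-R) R, ℝ)) ⊆ V := by
    rintro _ ⟨p, -, rfl⟩
    have : (Polynomial.toContinuousMapOnAlgHom (Set.Icc (-R) R)) p =
        ∑ i ∈ Finset.range (p.natDegree + 1), p.coeff i •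
          curveOf R (fun _ t => t ^ i) (by unfold Function.uncurry; fun_prop) 0 := by
      ext t
      simp [curveOf_apply, Polynomial.eval_eq_sum_range, ContinuousMap.sum_apply]
    change (Polynomial.toContinuousMapOnAlgHom (Set.Icc (-R) R)) p ∈ V
    rw [this]
    exact V.sum_mem fun i _ => V.smul_mem _ (mono i)
  exact closure_minimal this hV hg

/-- span of cosines of affine functions -/
def TrigS (E : Type*) [NormedAddCommGroup E] [NormedSpace ℝ E] : Submodule ℝ (E → ℝ) :=
  Submodule.span ℝ {g | ∃ (l : E →L[ℝ] ℝ) (c : ℝ), g = fun x => Real.cos (l x + c)}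

/-- span of constants and ridge functions with activation `φ` -/
def NetS (E : Type*) [NormedAddCommGroup E] [NormedSpace ℝ E] (φ : ℝ → ℝ) : Submodule ℝ (E → ℝ) :=
  Submodule.span ℝ ({g | ∃ (l : E →L[ℝ] ℝ) (c : ℝ), g = fun x => φ (l x + c)} ∪ {fun _ => 1})

lemma cos_approx (φ : ℝ → ℝ) (hφ : ContDiff ℝ 1 φ)
    (hφnp : ¬∃ p : Polynomial ℝ, ∀ x, φ x = p.eval x) (R δ : ℝ) (hδ : 0 < δ) :
    ∃ H ∈ Submodule.span ℝ {g : ℝ → ℝ | ∃ w c : ℝ, g = fun t => φ (w * t + c)},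
      ∀ s ∈ Set.Icc (-R) R, ∀ t ∈ Set.Icc (-R) R,
        |(Real.cos s - H s) - (Real.cos t - H t)| ≤ δ * |s - t| := by
  have hdiff : Differentiable ℝ φ := hφ.differentiable (by norm_num)
  have hσ : Continuous (deriv φ) := hφ.continuous_deriv (by norm_num)
  have hnp : ¬∃ p : Polynomial ℝ, ∀ x, deriv φ x = p.eval x := by
    rintro ⟨p, hp⟩
    apply hφnp
    obtain ⟨q, -, hq⟩ := eq_poly_of_deriv hdiff (k := p.natDegree + 1) (p := p)
      (Polynomial.degree_le_natDegree.trans_lt (by exact_mod_cast Nat.lt_succ_self _)) hp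
    exact ⟨q, hq⟩
  have hd := span_dense R (deriv φ) hσ hnp
  let g : C(Set.Icc (-R) R, ℝ) := ⟨fun t => -Real.sin t, by fun_prop⟩
  have hg : g ∈ (Submodule.span ℝ {g : C(Set.Icc (-R) R, ℝ) | ∃ w c : ℝ, w ≠ 0 ∧
      ∀ t, g t = deriv φ (w * t + c)}).topologicalClosure := by rw [hd]; trivial
  obtain ⟨v, hv, hvd⟩ := Metric.mem_closure_iff.1 hg δ hδ
  have key : ∀ v ∈ Submodule.span ℝ {g : C(Set.Icc (-R) R, ℝ) | ∃ w c : ℝ, w ≠ 0 ∧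
      ∀ t, g t = deriv φ (w * t + c)},
      ∃ H ∈ Submodule.span ℝ {g : ℝ → ℝ | ∃ w c : ℝ, g = fun t => φ (w * t + c)},
        ∀ t : Set.Icc (-R) R, HasDerivAt H (v t) t := by
    intro v hv
    induction hv using Submodule.span_induction with
    | mem v hv =>
      obtain ⟨w, c, hw, hv⟩ := hv
      refine ⟨w⁻¹ • (fun t => φ (w * t + c)), Submodule.smul_mem _ _
        (Submodule.subset_span ⟨w, c, rfl⟩), fun t => ?_⟩
      have h2 : HasDerivAt (fun s : ℝ => w * s + c) w t := by
        simpa using ((hasDerivAt_id (t : ℝ)).const_mul w).add_const c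
      have h3 := ((hdiff (w * t + c)).hasDerivAt.comp (t : ℝ) h2).const_mul w⁻¹
      exact h3.congr_deriv (by rw [hv]; field_simp)
    | zero => exact ⟨0, Submodule.zero_mem _, fun t => hasDerivAt_const _ _⟩
    | add x y _ _ hx hy =>
      obtain ⟨H1, h1, h1'⟩ := hx
      obtain ⟨H2, h2, h2'⟩ := hy
      exact ⟨H1 + H2, Submodule.add_mem _ h1 h2, fun t => (h1' t).add (h2' t)⟩
    | smul a x _ hx =>
      obtain ⟨H1, h1, h1'⟩ := hx
      exact ⟨a • H1, Submodule.smul_mem _ _ h1, fun t => (h1' t).const_smul a⟩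
  obtain ⟨H, hH, hHd⟩ := key v hv
  refine ⟨H, hH, fun s hs t ht => ?_⟩
  have := (convex_Icc (-R) R).norm_image_sub_le_of_norm_hasDerivWithin_le
    (f := fun t => Real.cos t - H t) (f' := fun t => if h : t ∈ Set.Icc (-R) R then
      -Real.sin t - v ⟨t, h⟩ else 0) (C := δ) (fun x hx => by
        rw [dif_pos hx]
        exact ((Real.hasDerivAt_cos x).sub (hHd ⟨x, hx⟩)).hasDerivWithinAt) (fun x hx => by
        rw [dif_pos hx]
        have h1 := ContinuousMap.dist_apply_le_dist (f := g) (g := v) ⟨x, hx⟩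
        rw [Real.dist_eq] at h1
        exact h1.trans hvd.le) ht hs
  simpa using this

section
variable {E : Type*} [NormedAddCommGroup E] [NormedSpace ℝ E]

lemma net_comp (φ : ℝ → ℝ) (H : ℝ → ℝ)
    (hH : H ∈ Submodule.span ℝ {g : ℝ → ℝ | ∃ w c : ℝ, g = fun t => φ (w * t + c)})
    (l : E →L[ℝ] ℝ) (c : ℝ) : (fun x => H (l x + c)) ∈ NetS E φ := by
  induction hH using Submodule.span_induction with
  | mem v hv =>
    obtain ⟨w, c', rfl⟩ := hv
    apply Submodule.subset_span
    left
    refine ⟨w • l, w * c + c', ?_⟩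
    funext x
    simp
    congr 1
    ring
  | zero => exact Submodule.zero_mem _
  | add x y _ _ hx hy => exact Submodule.add_mem _ hx hy
  | smul a x _ hx => exact Submodule.smul_mem _ a hx

lemma trig_approx (φ : ℝ → ℝ) (hφ : ContDiff ℝ 1 φ)
    (hφnp : ¬∃ p : Polynomial ℝ, ∀ x, φ x = p.eval x) (K : Set E) (hK : Bornology.IsBounded K)
    (T : E → ℝ) (hT : T ∈ TrigS E) : ∀ δ > (0 : ℝ), ∃ H ∈ NetS E φ, ∀ x ∈ K, ∀ y ∈ K,
      |(T x - H x) - (T y - H y)| ≤ δ * ‖x - y‖ := by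
  induction hT using Submodule.span_induction with
  | mem v hv =>
    obtain ⟨l, c, rfl⟩ := hv
    intro δ hδ
    obtain ⟨r, hr⟩ := hK.subset_closedBall (0 : E)
    obtain ⟨H, hH, hHd⟩ := cos_approx φ hφ hφnp (‖l‖ * r + |c|) (δ / (‖l‖ + 1)) (by positivity)
    have hb : ∀ x ∈ K, l x + c ∈ Set.Icc (-(‖l‖ * r + |c|)) (‖l‖ * r + |c|) := by
      intro x hx
      apply Set.mem_Icc.2
      rw [← abs_le]
      have h1 : ‖x‖ ≤ r := by simpa using hr hx
      have h2 : |l x| ≤ ‖l‖ * r := (l.le_opNorm x).trans (by gcongr)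
      exact (abs_add_le _ _).trans (by gcongr)
    refine ⟨_, net_comp φ H hH l c, fun x hx y hy => ?_⟩
    refine (hHd _ (hb x hx) _ (hb y hy)).trans ?_
    have h2 : |l x + c - (l y + c)| ≤ ‖l‖ * ‖x - y‖ := by
      have := l.le_opNorm (x - y)
      rw [map_sub] at this
      simpa using this
    calc δ / (‖l‖ + 1) * |l x + c - (l y + c)| ≤ δ / (‖l‖ + 1) * ((‖l‖ + 1) * ‖x - y‖) := by
          gcongr
          exact h2.trans (by gcongr; linarith)
      _ = δ * ‖x - y‖ := by field_simp
  | zero => exact fun δ hδ => ⟨0, Submodule.zero_mem _, fun x _ y _ => by simp; positivity⟩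
  | add x y _ _ hx hy =>
    intro δ hδ
    obtain ⟨H1, h1, h1'⟩ := hx (δ / 2) (by positivity)
    obtain ⟨H2, h2, h2'⟩ := hy (δ / 2) (by positivity)
    refine ⟨H1 + H2, Submodule.add_mem _ h1 h2, fun a ha b hb => ?_⟩
    have e1 := abs_le.1 (h1' a ha b hb)
    have e2 := abs_le.1 (h2' a ha b hb)
    simp only [Pi.add_apply]
    rw [abs_le]
    constructor <;> linarith [e1.1, e1.2, e2.1, e2.2]
  | smul a x _ hx =>
    intro δ hδ
    obtain ⟨H1, h1, h1'⟩ := hx (δ / (|a| + 1)) (by positivity)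
    refine ⟨a • H1, Submodule.smul_mem _ _ h1, fun u hu v hv => ?_⟩
    have e1 := h1' u hu v hv
    simp only [Pi.smul_apply, smul_eq_mul]
    rw [show a * x u - a * H1 u - (a * x v - a * H1 v) = a * (x u - H1 u - (x v - H1 v)) by ring,
      abs_mul]
    calc |a| * |x u - H1 u - (x v - H1 v)| ≤ (|a| + 1) * (δ / (|a| + 1) * ‖u - v‖) := by
          gcongr
          linarith
      _ = δ * ‖u - v‖ := by field_simp

lemma trig_mul (f g : E → ℝ) (hf : f ∈ TrigS E) (hg : g ∈ TrigS E) : f * g ∈ TrigS E := by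
  unfold TrigS at hf hg
  induction hf, hg using Submodule.span_induction₂ with
  | mem_mem f g hf hg =>
    obtain ⟨l, c, rfl⟩ := hf
    obtain ⟨l', c', rfl⟩ := hg
    have : ((fun x => Real.cos (l x + c)) * (fun x => Real.cos (l' x + c')) : E → ℝ) =
        (1 / 2 : ℝ) • ((fun x => Real.cos ((l + l') x + (c + c'))) +
          (fun x => Real.cos ((l - l') x + (c - c')))) := by
      funext x
      simp only [Pi.mul_apply, Pi.smul_apply, Pi.add_apply, smul_eq_mul,
        _root_.add_apply, _root_.sub_apply]
      rw [show l x + l' x + (c + c') = (l x + c) + (l' x + c') by ring,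
        show l x - l' x + (c - c') = (l x + c) - (l' x + c') by ring,
        Real.cos_add (l x + c), Real.cos_sub (l x + c)]
      ring
    rw [this]
    exact Submodule.smul_mem _ _ (Submodule.add_mem _ (Submodule.subset_span ⟨_, _, rfl⟩)
      (Submodule.subset_span ⟨_, _, rfl⟩))
  | zero_left y _ => rw [zero_mul]; exact Submodule.zero_mem _
  | zero_right y _ => rw [mul_zero]; exact Submodule.zero_mem _
  | add_left x y z _ _ _ h1 h2 => rw [add_mul]; exact Submodule.add_mem _ h1 h2
  | add_right x y z _ _ _ h1 h2 => rw [mul_add]; exact Submodule.add_mem _ h1 h2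
  | smul_left r x y _ _ h => rw [smul_mul_assoc]; exact Submodule.smul_mem _ _ h
  | smul_right r x y _ _ h => rw [mul_smul_comm]; exact Submodule.smul_mem _ _ h

lemma trig_one : (1 : E → ℝ) ∈ TrigS E :=
  Submodule.subset_span ⟨0, 0, by funext x; simp⟩

lemma trig_pow (f : E → ℝ) (hf : f ∈ TrigS E) (n : ℕ) : f ^ n ∈ TrigS E := by
  induction n with
  | zero => rw [pow_zero]; exact trig_one
  | succ n ih => rw [pow_succ]; exact trig_mul _ _ ih hf

lemma trig_cont (f : E → ℝ) (hf : f ∈ TrigS E) : Continuous f := by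
  induction hf using Submodule.span_induction with
  | mem v hv => obtain ⟨l, c, rfl⟩ := hv; fun_prop
  | zero => exact continuous_const
  | add x y _ _ hx hy => exact hx.add hy
  | smul a x _ hx => exact hx.const_smul a

open MeasureTheory in
lemma trig_conv [MeasurableSpace E] [BorelSpace E] (μ : Measure E) [IsFiniteMeasureOnCompacts μ]
    (F : E → ℝ) (hF : Continuous F) (hc : HasCompactSupport F) (k : E → ℝ) (hk : k ∈ TrigS E) :
    (fun x => ∫ y, F y * k (x - y) ∂μ) ∈ TrigS E := by
  have hi : ∀ g : E → ℝ, Continuous g → Integrable (fun y => F y * g y) μ := fun g hg =>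
    (hF.mul hg).integrable_of_hasCompactSupport hc.mul_right
  induction hk using Submodule.span_induction with
  | mem v hv =>
    obtain ⟨l, c, rfl⟩ := hv
    have : (fun x => ∫ y, F y * Real.cos (l (x - y) + c) ∂μ) =
        (∫ y, F y * Real.cos (l y) ∂μ) • (fun x => Real.cos (l x + c)) +
        (∫ y, F y * Real.sin (l y) ∂μ) • (fun x => Real.cos (l x + (c - Real.pi / 2))) := by
      funext x
      simp only [Pi.add_apply, Pi.smul_apply, smul_eq_mul]
      rw [← integral_mul_const, ← integral_mul_const, ← integral_add]
      · congr 1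
        funext y
        rw [map_sub, show l x - l y + c = (l x + c) - l y by ring, Real.cos_sub,
          show l x + (c - Real.pi / 2) = (l x + c) - Real.pi / 2 by ring, Real.cos_sub_pi_div_two]
        ring
      · exact (hi _ (by fun_prop)).mul_const _
      · exact (hi _ (by fun_prop)).mul_const _
    rw [this]
    exact Submodule.add_mem _ (Submodule.smul_mem _ _ (Submodule.subset_span ⟨_, _, rfl⟩))
      (Submodule.smul_mem _ _ (Submodule.subset_span ⟨_, _, rfl⟩))
  | zero =>
    have h0 : (fun x : E => ∫ y, F y * (0 : E → ℝ) (x - y) ∂μ) = 0 := by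
      funext x
      simp
    rw [h0]
    exact Submodule.zero_mem _
  | add x y hx' hy' hx hy =>
    have h1 := trig_cont x hx'
    have h2 := trig_cont y hy'
    have := Submodule.add_mem _ hx hy
    convert this using 1
    funext z
    simp only [Pi.add_apply, mul_add]
    exact integral_add (hi _ (by fun_prop)) (hi _ (by fun_prop))
  | smul a x _ hx =>
    have := Submodule.smul_mem _ a hx
    convert this using 1
    funext z
    simp only [Pi.smul_apply, smul_eq_mul]
    rw [← integral_const_mul]
    congr 1
    funext y
    ring

open MeasureTheory in
lemma mollify [FiniteDimensional ℝ E] [MeasurableSpace E] [BorelSpace E] (F : E → ℝ) (L : NNReal)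
    (hF : LipschitzWith L F) (hc : HasCompactSupport F) (K : Set E) (hK : Bornology.IsBounded K)
    (ε : ℝ) (hε : 0 < ε) :
    ∃ T ∈ TrigS E, (∀ x ∈ K, ∀ y ∈ K, |T x - T y| ≤ L * ‖x - y‖) ∧ ∀ x ∈ K, |F x - T x| ≤ ε := by
  obtain ⟨r, hr0, hr⟩ : ∃ r > 0, K ∪ tsupport F ⊆ Metric.closedBall (0 : E) r := by
    obtain ⟨r, hr⟩ := (hK.union hc.isCompact.isBounded).subset_closedBall (0 : E)
    exact ⟨max r 1, by positivity, hr.trans (Metric.closedBall_subset_closedBall (le_max_left _ _))⟩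
  have : ProperSpace E := FiniteDimensional.proper ℝ E
  let μ : Measure E := Measure.addHaar
  let S : Set E := Metric.closedBall 0 (2 * r)
  have hS : IsCompact S := isCompact_closedBall _ _
  let b := Module.finBasis ℝ E
  let l : Fin (Module.finrank ℝ E) → E →L[ℝ] ℝ := fun j => LinearMap.toContinuousLinearMap (b.coord j)
  let A : ℝ := 2 * r * (∑ j, ‖l j‖) + 1
  have hA : 0 < A := by positivity
  let c : E → ℝ := 1 + ∑ j, (1 + fun x => Real.cos ((A⁻¹ • l j) x + 0))
  have hcT : c ∈ TrigS E := Submodule.add_mem _ trig_one (Submodule.sum_mem _ fun j _ =>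
    Submodule.add_mem _ trig_one (Submodule.subset_span ⟨_, _, rfl⟩))
  have hcc : Continuous c := trig_cont c hcT
  have hce : ∀ u, c u = 1 + ∑ j, (1 + Real.cos (A⁻¹ * l j u)) := by
    intro u; simp [c]
  have hcpos : ∀ u, 0 < c u := by
    intro u
    rw [hce]
    have : 0 ≤ ∑ j, (1 + Real.cos (A⁻¹ * l j u)) :=
      Finset.sum_nonneg fun j _ => by linarith [Real.neg_one_le_cos (A⁻¹ * l j u)]
    linarith
  have hmax : ∀ u ∈ S, u ≠ 0 → c u < c 0 := by
    intro u hu hu0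
    rw [hce, hce]
    have hex : ∃ j, l j u ≠ 0 := by
      by_contra hcon
      push Not at hcon
      apply hu0
      apply b.ext_elem
      intro j
      simpa [l] using hcon j
    obtain ⟨j, hj⟩ := hex
    have : ∑ j, (1 + Real.cos (A⁻¹ * l j u)) < ∑ j, (1 + Real.cos (A⁻¹ * l j 0)) := by
      apply Finset.sum_lt_sum
      · intro i _
        simp [Real.cos_le_one]
      · refine ⟨j, Finset.mem_univ _, ?_⟩
        have h1 : |A⁻¹ * l j u| ≤ 1 := by
          rw [abs_mul, abs_of_pos (inv_pos.2 hA), inv_mul_le_iff₀ hA, mul_one]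
          have h2 : ‖u‖ ≤ 2 * r := by simpa [S] using hu
          have h3 : |l j u| ≤ ‖l j‖ * (2 * r) := ((l j).le_opNorm u).trans (by gcongr)
          have h4 : ‖l j‖ ≤ ∑ j, ‖l j‖ :=
            Finset.single_le_sum (f := fun j => ‖l j‖) (fun i _ => norm_nonneg _) (Finset.mem_univ j)
          have h5 : ‖l j‖ * (2 * r) ≤ (∑ j, ‖l j‖) * (2 * r) := by gcongr
          simp only [A]
          linarith
        have hne : A⁻¹ * l j u ≠ 0 := mul_ne_zero (inv_ne_zero hA.ne') hj
        have hlt : Real.cos (A⁻¹ * l j u) ≠ 1 := by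
          intro h
          have hpi := Real.pi_gt_three
          have h1' := abs_le.1 h1
          exact hne ((Real.cos_eq_one_iff_of_lt_of_lt (by linarith) (by linarith)).1 h)
        have := lt_of_le_of_ne (Real.cos_le_one (A⁻¹ * l j u)) hlt
        simpa using this
    linarith
  have ht := tendsto_setIntegral_pow_smul_of_unique_maximum_of_isCompact_of_continuousOn (μ := μ)
    (g := fun u : E => ‖u‖) hS hcc.continuousOn hmax (fun u _ => (hcpos u).le) (hcpos 0)
    (subset_closure (by
      rw [mem_interior_iff_mem_nhds]
      exact Metric.closedBall_mem_nhds _ (by positivity))) continuous_norm.continuousOn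
  rw [norm_zero] at ht
  obtain ⟨n, hn⟩ := ((tendsto_order.1 ht).2 (ε / (L + 1)) (by positivity)).exists
  let I : ℝ := ∫ x in S, c x ^ n ∂μ
  have hIntg : ∀ g : E → ℝ, Continuous g → IntegrableOn g S μ := fun g hg =>
    hg.continuousOn.integrableOn_compact hS
  have hI : 0 < I := by
    have h1 : (0 : E) ∈ interior S := by
      rw [mem_interior_iff_mem_nhds]
      exact Metric.closedBall_mem_nhds _ (by positivity)
    have h2 : 0 < μ S := lt_of_lt_of_le (isOpen_interior.measure_pos μ ⟨0, h1⟩)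
      (measure_mono interior_subset)
    apply (setIntegral_pos_iff_support_of_nonneg_ae _ (hIntg _ (hcc.pow n))).2
    · have : Function.support (c ^ n) = Set.univ := by
        ext x
        simp [(pow_pos (hcpos x) n).ne']
      rw [this, Set.univ_inter]
      exact h2
    · exact Filter.Eventually.of_forall fun x => (pow_pos (hcpos x) n).le
  let T : E → ℝ := I⁻¹ • fun x => ∫ y, F y * (c ^ n) (x - y) ∂μ
  have hFc := hF.continuous
  have hT : T ∈ TrigS E := Submodule.smul_mem _ _ (trig_conv μ F hFc hc _ (trig_pow c hcT n))
  have hTe : ∀ x ∈ K, T x = I⁻¹ * ∫ u in S, F (x - u) * c u ^ n ∂μ := by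
    intro x hx
    simp only [T, Pi.smul_apply, smul_eq_mul, Pi.pow_apply]
    congr 1
    rw [← integral_sub_left_eq_self _ μ x]
    simp only [sub_sub_cancel]
    rw [setIntegral_eq_integral_of_forall_compl_eq_zero]
    intro u hu
    have hx' : ‖x‖ ≤ r := by simpa using hr (Or.inl hx)
    have hz : F (x - u) = 0 := by
      by_contra hne
      have h1 : ‖x - u‖ ≤ r := by
        simpa using hr (Or.inr (subset_tsupport F hne))
      apply hu
      have : ‖u‖ ≤ ‖x‖ + ‖x - u‖ := by
        calc ‖u‖ = ‖x - (x - u)‖ := by simp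
          _ ≤ _ := norm_sub_le _ _
      simp only [S, mem_closedBall_zero_iff]
      linarith
    rw [hz, zero_mul]
  have hlip : ∀ x y, |F x - F y| ≤ L * ‖x - y‖ := fun x y => by
    have := hF.dist_le_mul x y
    rwa [Real.dist_eq, dist_eq_norm] at this
  have hIe : ∀ a : ℝ, a = I⁻¹ * ∫ u in S, a * c u ^ n ∂μ := by
    intro a
    rw [integral_const_mul]
    change a = I⁻¹ * (a * I)
    field_simp
  refine ⟨T, hT, fun x hx y hy => ?_, fun x hx => ?_⟩
  · rw [hTe x hx, hTe y hy, ← mul_sub, ← integral_sub (hIntg _ (by fun_prop)) (hIntg _ (by fun_prop)),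
      abs_mul, abs_of_pos (inv_pos.2 hI), hIe (L * ‖x - y‖)]
    gcongr
    rw [← Real.norm_eq_abs]
    refine norm_integral_le_of_norm_le (hIntg (fun u => L * ‖x - y‖ * c u ^ n) (by fun_prop)) (Filter.Eventually.of_forall fun u => ?_)
    rw [← sub_mul, norm_mul, Real.norm_eq_abs, Real.norm_eq_abs, abs_of_pos (pow_pos (hcpos u) n)]
    have := hlip (x - u) (y - u)
    rw [sub_sub_sub_cancel_right] at this
    have hp := (pow_pos (hcpos u) n).le
    gcongr
  · rw [hTe x hx, hIe (F x), ← mul_sub, ← integral_sub (hIntg _ (by fun_prop)) (hIntg _ (by fun_prop)),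
      abs_mul, abs_of_pos (inv_pos.2 hI)]
    have h1 : |∫ u in S, (F x * c u ^ n - F (x - u) * c u ^ n) ∂μ| ≤
        ∫ u in S, L * (c u ^ n • ‖u‖) ∂μ := by
      rw [← Real.norm_eq_abs]
      refine norm_integral_le_of_norm_le (hIntg (fun u => L * (c u ^ n • ‖u‖)) (by fun_prop))
        (Filter.Eventually.of_forall fun u => ?_)
      rw [← sub_mul, norm_mul, Real.norm_eq_abs, Real.norm_eq_abs, abs_of_pos (pow_pos (hcpos u) n)]
      have := hlip x (x - u)
      rw [sub_sub_cancel] at this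
      have hp := (pow_pos (hcpos u) n).le
      calc |F x - F (x - u)| * c u ^ n ≤ (L * ‖u‖) * c u ^ n := by gcongr
        _ = _ := by rw [smul_eq_mul]; ring
    rw [integral_const_mul] at h1
    simp only [smul_eq_mul] at hn h1
    calc I⁻¹ * |∫ u in S, (F x * c u ^ n - F (x - u) * c u ^ n) ∂μ|
        ≤ I⁻¹ * (L * ∫ u in S, c u ^ n * ‖u‖ ∂μ) := by gcongr
      _ = L * (I⁻¹ * ∫ u in S, c u ^ n * ‖u‖ ∂μ) := by ring
      _ ≤ L * (ε / (L + 1)) := by gcongr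
      _ ≤ (L + 1) * (ε / (L + 1)) := by gcongr; linarith
      _ = ε := by field_simp

end

section
variable {E : Type*} [NormedAddCommGroup E] [NormedSpace ℝ E]

lemma extend_cpt [FiniteDimensional ℝ E] (f : E → ℝ) (L : NNReal) (hL : 0 < L) (K : Set E)
    (hK : Bornology.IsBounded K) (hf : LipschitzOnWith L f K) :
    ∃ F : E → ℝ, LipschitzWith L F ∧ HasCompactSupport F ∧ Set.EqOn f F K := by
  have : ProperSpace E := FiniteDimensional.proper ℝ E
  obtain ⟨G, hG, hGe⟩ := hf.extend_real
  obtain ⟨r, hr⟩ := hK.subset_closedBall (0 : E)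
  have hL' : (0 : ℝ) < L := hL
  let ρ : ℝ := r + (|G 0| + L * r) / L
  let h : E → ℝ := fun x => L * max 0 (ρ - ‖x‖)
  have hh : LipschitzWith L h := by
    apply LipschitzWith.of_dist_le_mul
    intro x y
    simp only [h, dist_eq_norm, Real.norm_eq_abs]
    rw [← mul_sub, abs_mul, abs_of_pos hL']
    gcongr
    rw [max_comm 0, max_comm 0]
    refine (abs_max_sub_max_le_abs _ _ _).trans ?_ |>.trans (abs_norm_sub_norm_le x y)
    · rw [show ρ - ‖x‖ - (ρ - ‖y‖) = -(‖x‖ - ‖y‖) by ring, abs_neg]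
  have hh0 : ∀ x, 0 ≤ h x := fun x => by positivity
  refine ⟨fun x => max (min (G x) (h x)) (-h x), ?_, ?_, ?_⟩
  · have := (hG.min hh).max hh.neg
    simpa using this
  · refine HasCompactSupport.intro (isCompact_closedBall (0 : E) ρ) ?_
    intro x hx
    have hx' : ρ < ‖x‖ := by simpa using hx
    have : h x = 0 := by
      simp only [h]
      rw [max_eq_left (by linarith), mul_zero]
    simp [this]
  · intro x hx
    have hx' : ‖x‖ ≤ r := by simpa using hr hx
    have h1 := hG.dist_le_mul x 0
    rw [Real.dist_eq, dist_zero_right] at h1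
    have h2 : |G x| ≤ |G 0| + L * r := by
      have e1 : |G x| ≤ |G x - G 0| + |G 0| := by
        simpa using abs_add_le (G x - G 0) (G 0)
      have e2 : (L : ℝ) * ‖x‖ ≤ L * r := by gcongr
      linarith
    have h3 : |G 0| + L * r ≤ h x := by
      simp only [h]
      calc |G 0| + L * r = L * ((|G 0| + L * r) / L) := by field_simp
        _ ≤ L * max 0 (ρ - ‖x‖) := by
          gcongr
          refine le_trans ?_ (le_max_right _ _)
          simp only [ρ]
          linarith
    have h4 := abs_le.1 (h2.trans h3)
    simp only
    rw [hGe hx, min_eq_left h4.2, max_eq_left h4.1]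

lemma single_approx [FiniteDimensional ℝ E] (φ : ℝ → ℝ) (hφ : ContDiff ℝ 1 φ)
    (hφnp : ¬∃ p : Polynomial ℝ, ∀ x, φ x = p.eval x) (K : Set E) (hK : Bornology.IsBounded K)
    (L : ℝ) (hL : 0 < L) (f : E → ℝ) (hf : ∀ x ∈ K, ∀ y ∈ K, |f x - f y| ≤ L * ‖x - y‖)
    (ε : ℝ) (hε : 0 < ε) :
    ∃ H ∈ NetS E φ, (∀ x ∈ K, ∀ y ∈ K, |H x - H y| ≤ L * ‖x - y‖) ∧ ∀ x ∈ K, |f x - H x| ≤ ε := by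
  rcases K.eq_empty_or_nonempty with rfl | ⟨x0, hx0⟩
  · exact ⟨0, Submodule.zero_mem _, by simp, by simp⟩
  letI : MeasurableSpace E := borel E
  haveI : BorelSpace E := ⟨rfl⟩
  lift L to NNReal using hL.le
  obtain ⟨F, hF, hFc, hFe⟩ := extend_cpt f L (by exact_mod_cast hL) K hK
    (LipschitzOnWith.of_dist_le_mul fun x hx y hy => by
      rw [Real.dist_eq, dist_eq_norm]; exact hf x hx y hy)
  obtain ⟨T, hT, hTl, hTa⟩ := mollify F L hF hFc K hK (ε / 2) (by positivity)
  obtain ⟨r, hr⟩ := hK.subset_closedBall (0 : E)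
  have hr' : ∀ x ∈ K, ‖x‖ ≤ r := fun x hx => by simpa using hr hx
  have hr0 : 0 ≤ r := (norm_nonneg _).trans (hr' x0 hx0)
  let M : ℝ := |T x0| + L * (2 * r)
  have hTM : ∀ x ∈ K, |T x| ≤ M := by
    intro x hx
    have e1 : |T x| ≤ |T x - T x0| + |T x0| := by
      simpa using abs_add_le (T x - T x0) (T x0)
    have e2 := hTl x hx x0 hx0
    have e3 : ‖x - x0‖ ≤ 2 * r := (norm_sub_le _ _).trans (by linarith [hr' x hx, hr' x0 hx0])
    have e4 : (L : ℝ) * ‖x - x0‖ ≤ L * (2 * r) := by gcongr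
    simp only [M]
    linarith
  have hM : 0 ≤ M := by positivity
  let D : ℝ := M + L * (2 * r) + 1
  have hD : 0 < D := by positivity
  obtain ⟨η, hη0, hη1, hη⟩ : ∃ η : ℝ, 0 < η ∧ η ≤ 1 ∧ η * D ≤ ε / 2 := by
    refine ⟨min 1 (ε / 2 / D), by positivity, min_le_left _ _, ?_⟩
    calc min 1 (ε / 2 / D) * D ≤ (ε / 2 / D) * D := by gcongr; exact min_le_right _ _
      _ = ε / 2 := by field_simp
  obtain ⟨H, hH, hHa⟩ := trig_approx φ hφ hφnp K hK ((1 - η) • T) (Submodule.smul_mem _ _ hT)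
    (η * L) (by positivity)
  simp only [Pi.smul_apply, smul_eq_mul] at hHa
  refine ⟨H + ((1 - η) * T x0 - H x0) • (fun _ => 1), Submodule.add_mem _ hH
    (Submodule.smul_mem _ _ (Submodule.subset_span (Or.inr rfl))), fun x hx y hy => ?_,
    fun x hx => ?_⟩
  · simp only [Pi.add_apply, Pi.smul_apply, smul_eq_mul]
    have e1 := abs_le.1 (hHa x hx y hy)
    have e2 := abs_le.1 (hTl x hx y hy)
    have e3 : (1 - η) * (T x - T y) ≤ (1 - η) * (L * ‖x - y‖) :=
      mul_le_mul_of_nonneg_left e2.2 (by linarith)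
    have e4 : (1 - η) * (-(L * ‖x - y‖)) ≤ (1 - η) * (T x - T y) :=
      mul_le_mul_of_nonneg_left e2.1 (by linarith)
    rw [abs_le]
    constructor <;> linarith [e1.1, e1.2]
  · simp only [Pi.add_apply, Pi.smul_apply, smul_eq_mul]
    have e1 := abs_le.1 (hHa x hx x0 hx0)
    have e3 : ‖x - x0‖ ≤ 2 * r := (norm_sub_le _ _).trans (by linarith [hr' x hx, hr' x0 hx0])
    have e4 : η * L * ‖x - x0‖ ≤ η * (L * (2 * r)) := by rw [mul_assoc]; gcongr
    have e5 := abs_le.1 (hTa x hx)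
    rw [← hFe hx] at e5
    have e6 := abs_le.1 (hTM x hx)
    have e7 : η * T x ≤ η * M := mul_le_mul_of_nonneg_left e6.2 hη0.le
    have e8 : η * (-M) ≤ η * T x := mul_le_mul_of_nonneg_left e6.1 hη0.le
    have e9 : η * M + η * (L * (2 * r)) + η ≤ ε / 2 := by
      refine le_trans (le_of_eq ?_) hη
      simp only [D]; ring
    rw [abs_le]
    constructor <;> linarith [e1.1, e1.2, e5.1, e5.2]

/-- width-`m` networks -/
def IsNet (φ : ℝ → ℝ) (m : ℕ) (H : E → ℝ) : Prop :=
  ∃ (b : ℝ) (a c : Fin m → ℝ) (l : Fin m → E →L[ℝ] ℝ), H = fun x => b + ∑ i, a i * φ (l i x + c i)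

lemma IsNet.add {φ : ℝ → ℝ} {m n : ℕ} {H G : E → ℝ} (h : IsNet φ m H) (g : IsNet φ n G) :
    IsNet φ (m + n) (H + G) := by
  obtain ⟨b, a, c, l, rfl⟩ := h
  obtain ⟨b', a', c', l', rfl⟩ := g
  refine ⟨b + b', Fin.append a a', Fin.append c c', Fin.append l l', ?_⟩
  funext x
  simp [Fin.sum_univ_add]
  ring

lemma IsNet.const (φ : ℝ → ℝ) (m : ℕ) (r : ℝ) : IsNet φ m (fun _ : E => r) :=
  ⟨r, 0, 0, 0, by simp⟩

lemma IsNet.mono {φ : ℝ → ℝ} {m n : ℕ} {H : E → ℝ} (h : IsNet φ m H) (hmn : m ≤ n) (r : ℝ) :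
    IsNet φ n (fun x => H x + r) := by
  obtain ⟨k, rfl⟩ := Nat.exists_eq_add_of_le hmn
  exact h.add (IsNet.const φ k r)

lemma isNet_of_mem (φ : ℝ → ℝ) (H : E → ℝ) (hH : H ∈ NetS E φ) : ∃ m, IsNet φ m H := by
  induction hH using Submodule.span_induction with
  | mem v hv =>
    rcases hv with ⟨l, c, rfl⟩ | hv
    · exact ⟨1, 0, fun _ => 1, fun _ => c, fun _ => l, by simp⟩
    · rw [Set.mem_singleton_iff] at hv
      subst hv
      exact ⟨0, IsNet.const φ 0 1⟩
  | zero => exact ⟨0, IsNet.const φ 0 0⟩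
  | add x y _ _ hx hy =>
    obtain ⟨m, hm⟩ := hx
    obtain ⟨n, hn⟩ := hy
    exact ⟨m + n, hm.add hn⟩
  | smul r x _ hx =>
    obtain ⟨m, b, a, c, l, rfl⟩ := hx
    refine ⟨m, r * b, r • a, c, l, ?_⟩
    funext x
    simp [mul_add, Finset.mul_sum, mul_assoc]

lemma uniform_approx [FiniteDimensional ℝ E] (φ : ℝ → ℝ) (hφ : ContDiff ℝ 1 φ)
    (hφnp : ¬∃ p : Polynomial ℝ, ∀ x, φ x = p.eval x) (K : Set E) (hK : Bornology.IsBounded K)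
    (L : ℝ) (hL : 0 < L) (ε : ℝ) (hε : 0 < ε) :
    ∃ m, ∀ f : E → ℝ, (∀ x ∈ K, ∀ y ∈ K, |f x - f y| ≤ L * ‖x - y‖) →
    ∃ H, IsNet φ m H ∧ (∀ x ∈ K, ∀ y ∈ K, |H x - H y| ≤ L * ‖x - y‖) ∧
      ∀ x ∈ K, |f x - H x| ≤ ε := by
  have : ProperSpace E := FiniteDimensional.proper ℝ E
  rcases K.eq_empty_or_nonempty with rfl | ⟨x0, hx0⟩
  · exact ⟨0, fun f _ => ⟨_, IsNet.const φ 0 0, by simp, by simp⟩⟩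
  have htb : TotallyBounded K := TotallyBounded.subset subset_closure hK.isCompact_closure.totallyBounded
  obtain ⟨t, htK, htf, htc⟩ := Metric.finite_approx_of_totallyBounded htb (ε / 8 / L) (by positivity)
  haveI : Fintype t := htf.fintype
  obtain ⟨r, hr⟩ := hK.subset_closedBall x0
  let Fam : Set (E → ℝ) := {f | (∀ x ∈ K, ∀ y ∈ K, |f x - f y| ≤ L * ‖x - y‖) ∧ f x0 = 0}
  let Φ : (E → ℝ) → (t → ℝ) := fun f i => f i
  have hr0 : 0 ≤ r := dist_nonneg.trans (hr hx0)
  have hbd : Bornology.IsBounded (Φ '' Fam) := by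
    refine Metric.isBounded_closedBall (x := (0 : t → ℝ)) (r := L * r) |>.subset ?_
    rintro _ ⟨f, hf, rfl⟩
    rw [mem_closedBall_zero_iff, pi_norm_le_iff_of_nonneg (by positivity)]
    intro i
    have h1 := hf.1 i (htK i.2) x0 hx0
    rw [hf.2, sub_zero] at h1
    have h2 : ‖(i : E) - x0‖ ≤ r := by
      rw [← dist_eq_norm]
      exact hr (htK i.2)
    exact h1.trans (by gcongr)
  obtain ⟨s, hsF, hsf, hsc⟩ := Metric.finite_approx_of_totallyBounded (TotallyBounded.subset subset_closure hbd.isCompact_closure.totallyBounded) (ε / 4)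
    (by positivity)
  have hch : ∀ p : t → ℝ, ∃ m : ℕ, p ∈ s → ∃ f ∈ Fam, Φ f = p ∧ ∃ H : E → ℝ, IsNet φ m H ∧
      (∀ x ∈ K, ∀ y ∈ K, |H x - H y| ≤ L * ‖x - y‖) ∧ ∀ x ∈ K, |f x - H x| ≤ ε / 2 := by
    intro p
    by_cases hp : p ∈ s
    · obtain ⟨f, hf, hfp⟩ := hsF hp
      obtain ⟨H, hH, h1, h2⟩ := single_approx φ hφ hφnp K hK L hL f hf.1 (ε / 2) (by positivity)
      obtain ⟨m, hm⟩ := isNet_of_mem φ H hH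
      exact ⟨m, fun _ => ⟨f, hf, hfp, H, hm, h1, h2⟩⟩
    · exact ⟨0, fun h => absurd h hp⟩
  choose M hM using hch
  refine ⟨hsf.toFinset.sup M, fun f hf => ?_⟩
  have hg : (fun x => f x - f x0) ∈ Fam := by
    refine ⟨fun x hx y hy => ?_, by simp⟩
    simpa using hf x hx y hy
  have hin := hsc (Set.mem_image_of_mem Φ hg)
  simp only [Set.mem_iUnion] at hin
  obtain ⟨p, hp, hpd⟩ := hin
  obtain ⟨g, hgF, hgp, H, hH, hHl, hHa⟩ := hM p hp
  refine ⟨_, hH.mono (Finset.le_sup (f := M) (hsf.mem_toFinset.2 hp)) (f x0), fun x hx y hy => ?_,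
    fun x hx => ?_⟩
  · simpa using hHl x hx y hy
  · have hx' := htc hx
    simp only [Set.mem_iUnion] at hx'
    obtain ⟨z, hz, hzd⟩ := hx'
    have hzK := htK hz
    have e0 : L * ‖x - z‖ ≤ ε / 8 := by
      rw [Metric.mem_ball, dist_eq_norm] at hzd
      calc L * ‖x - z‖ ≤ L * (ε / 8 / L) := by gcongr
        _ = ε / 8 := by field_simp
    have e1 := abs_le.1 ((hf x hx z hzK).trans e0)
    have e2 := abs_le.1 ((hgF.1 x hx z hzK).trans e0)
    have e3 : |f z - f x0 - g z| ≤ ε / 4 := by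
      rw [← hgp, Metric.mem_ball] at hpd
      have := (dist_le_pi_dist (Φ fun x => f x - f x0) (Φ g) ⟨z, hz⟩).trans hpd.le
      rwa [Real.dist_eq] at this
    have e4 := abs_le.1 e3
    have e5 := abs_le.1 (hHa x hx)
    rw [abs_le]
    constructor <;> linarith [e1.1, e1.2, e2.1, e2.2, e4.1, e4.2, e5.1, e5.2]

end

/-- copy of `ℝ^d` to be normed by `N` -/
def NSpace {d : ℕ} (_N : (Fin d → ℝ) → ℝ) : Type := Fin d → ℝ

instance {d : ℕ} (N : (Fin d → ℝ) → ℝ) : AddCommGroup (NSpace N) :=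
  inferInstanceAs (AddCommGroup (Fin d → ℝ))

instance {d : ℕ} (N : (Fin d → ℝ) → ℝ) : Module ℝ (NSpace N) :=
  inferInstanceAs (Module ℝ (Fin d → ℝ))

/-- identity -/
def toNSpace {d : ℕ} (N : (Fin d → ℝ) → ℝ) : (Fin d → ℝ) ≃ₗ[ℝ] NSpace N :=
  LinearEquiv.refl ℝ (Fin d → ℝ)

/-- Main theorem, uniform version: for a `C¹` non-polynomial activation `φ`,
the width `m` can be chosen depending only on `ε`, such that every `L`-Lipschitz
function on the bounded set `K` admits an `L`-Lipschitz one-hidden-layer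
approximation of width `m` up to accuracy `ε` on `K`. -/
theorem stmt15 {d : ℕ} (N : (Fin d → ℝ) → ℝ) (hN : IsNorm N)
    (K : Set (Fin d → ℝ)) (hK : Bornology.IsBounded K)
    (L : ℝ) (hL : 0 < L) (φ : ℝ → ℝ) (hφ : ContDiff ℝ 1 φ)
    (hφnp : ¬∃ p : Polynomial ℝ, ∀ x, φ x = p.eval x) :
    ∀ ε > (0 : ℝ), ∃ m : ℕ,
      ∀ f : (Fin d → ℝ) → ℝ,
        (∀ x ∈ K, ∀ y ∈ K, |f x - f y| ≤ L * N (x - y)) →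
        ∃ (b : ℝ) (a c : Fin m → ℝ) (w : Fin m → Fin d → ℝ),
          ∃ fm : (Fin d → ℝ) → ℝ,
            fm = (fun x => b + ∑ i, a i * φ (∑ j, w i j * x j + c i)) ∧
            (∀ x ∈ K, ∀ y ∈ K, |fm x - fm y| ≤ L * N (x - y)) ∧
            (∀ x ∈ K, |f x - fm x| ≤ ε) := by
  intro ε hε
  obtain ⟨hN0, hNs, hNa⟩ := hN
  let e := toNSpace N
  letI : Norm (NSpace N) := ⟨fun x => N (e.symm x)⟩
  have hnd : ∀ x : NSpace N, ‖x‖ = N (e.symm x) := fun x => rfl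
  have core : NormedSpace.Core ℝ (NSpace N) :=
    { norm_nonneg := fun x => by
        rw [hnd]
        have h1 := hNa (e.symm x) ((-1 : ℝ) • e.symm x)
        rw [hNs] at h1
        have h2 : e.symm x + (-1 : ℝ) • e.symm x = 0 := by simp
        rw [h2, (hN0 0).2 rfl] at h1
        norm_num at h1
        linarith
      norm_smul := fun c x => by
        rw [hnd, hnd, map_smul, hNs, Real.norm_eq_abs]
      norm_triangle := fun x y => by
        rw [hnd, hnd, hnd, map_add]
        exact hNa _ _
      norm_eq_zero_iff := fun x => by
        rw [hnd, hN0, map_eq_zero_iff _ e.symm.injective] }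
  letI : NormedAddCommGroup (NSpace N) := NormedAddCommGroup.ofCore core
  letI : NormedSpace ℝ (NSpace N) := NormedSpace.ofCore core
  haveI : FiniteDimensional ℝ (NSpace N) := e.finiteDimensional
  have hne : ∀ x y, ‖e x - e y‖ = N (x - y) := fun x y => by
    rw [← map_sub, hnd, LinearEquiv.symm_apply_apply]
  let eL : (Fin d → ℝ) →L[ℝ] NSpace N := LinearMap.toContinuousLinearMap e.toLinearMap
  have hKb : Bornology.IsBounded (e '' K) := by
    exact eL.lipschitz.isBounded_image hK
  obtain ⟨m, hm⟩ := uniform_approx φ hφ hφnp (e '' K) hKb L hL ε hε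
  refine ⟨m, fun f hf => ?_⟩
  obtain ⟨H, ⟨b, a, c, l, hH⟩, hl, ha⟩ := hm (fun x => f (e.symm x)) (by
    rintro _ ⟨x, hx, rfl⟩ _ ⟨y, hy, rfl⟩
    rw [hne]
    simpa using hf x hx y hy)
  refine ⟨b, a, c, fun i j => l i (e (Pi.single j 1)), fun x => H (e x), ?_, ?_, ?_⟩
  · rw [hH]
    funext x
    have : ∀ i, l i (e x) = ∑ j, l i (e (Pi.single j 1)) * x j := by
      intro i
      have h1 := LinearMap.pi_apply_eq_sum_univ ((l i).toLinearMap ∘ₗ e.toLinearMap) x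
      have h2 : l i (e x) = ∑ j, x j • l i (e (Pi.single j 1)) := by
        rw [show l i (e x) = ((l i).toLinearMap ∘ₗ e.toLinearMap) x from rfl, h1]
        refine Finset.sum_congr rfl fun j _ => ?_
        have h3 : (fun k => if j = k then (1 : ℝ) else 0) = Pi.single j 1 := by
          funext k
          simp [Pi.single_apply, eq_comm]
        rw [h3]
        rfl
      rw [h2]
      exact Finset.sum_congr rfl fun j _ => by rw [smul_eq_mul, mul_comm]
    simp only [this]
  · intro x hx y hy
    rw [← hne]
    exact hl _ ⟨x, hx, rfl⟩ _ ⟨y, hy, rfl⟩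
  · intro x hx
    simpa using ha _ ⟨x, hx, rfl⟩
end
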